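/- For all integers b ≥ 1 and d ≥ 1 there exists a natural number N = f(b,d) with the following property. Let ℱ be a finite family of subsets of ℝ^d such that for every nonempty subfamily 𝒢 ⊆ ℱ the intersection ⋂𝒢 has at most b path-connected components, and each of these path-connected components, viewed as a subspace, is (⌈d/2⌉−1)-connected. Then, if ⋂ℱ = ∅, there exists a subfamily 𝒢 ⊆ ℱ with at most N elements and ⋂𝒢 = ∅. -/

import Mathlib

/-- A topological space is `k`-connected if it is nonempty, path-connected, and its
homotopy groups `π_j` are trivial for all `1 ≤ j ≤ k`. -/
def IsKConnectedSpace (k : ℕ) (X : Type) [TopologicalSpace X] : Prop :=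
  Nonempty X ∧ PathConnectedSpace X ∧
    ∀ j : ℕ, 1 ≤ j → j ≤ k → ∀ x : X, Subsingleton (HomotopyGroup (Fin j) X x)

/-- A real polynomial of odd degree has a real root. -/
theorem Polynomial.exists_isRoot_of_odd_natDegree_real (p : Polynomial ℝ)
    (hp : Odd p.natDegree) : ∃ x, p.IsRoot x := by
  have key : ∀ q : Polynomial ℝ, Odd q.natDegree → 0 ≤ q.leadingCoeff → ∃ x, 0 ≤ q.eval x := by
    intro q hq h
    have hdeg : 0 < q.degree := Polynomial.natDegree_pos_iff_degree_pos.1 hq.pos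
    exact ((q.tendsto_atTop_of_leadingCoeff_nonneg hdeg h).eventually_ge_atTop 0).exists
  have key' : ∀ q : Polynomial ℝ, Odd q.natDegree → ∃ x, 0 ≤ q.eval x := by
    intro q hq
    rcases le_total 0 q.leadingCoeff with h | h
    · exact key q hq h
    · have hX : (-Polynomial.X : Polynomial ℝ).natDegree = 1 := by simp
      have hd : (q.comp (-Polynomial.X)).natDegree = q.natDegree := by
        rw [Polynomial.natDegree_comp, hX, mul_one]
      obtain ⟨x, hx⟩ := key (q.comp (-Polynomial.X)) (hd ▸ hq) (by
        rw [Polynomial.leadingCoeff_comp (by rw [hX]; exact one_ne_zero)]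
        simp [hq.neg_one_pow, h])
      exact ⟨-x, by simpa using hx⟩
  obtain ⟨a, ha⟩ := key' p hp
  obtain ⟨b, hb⟩ := key' (-p) (by simpa using hp)
  exact mem_range_of_exists_le_of_exists_ge p.continuous ⟨b, by simpa using hb⟩ ⟨a, ha⟩

/-- A commuting family of endomorphisms of an odd-dimensional real vector space has a common
eigenvector. -/
theorem exists_common_eigenvector_of_odd_finrank {ι : Type*} (n : ℕ) :
    ∀ (V : Type) [AddCommGroup V] [Module ℝ V] [FiniteDimensional ℝ V]
      (L : ι → Module.End ℝ V), (∀ i j, Commute (L i) (L j)) → Module.finrank ℝ V = n → Odd n →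
      ∃ w : V, w ≠ 0 ∧ ∃ c : ι → ℝ, ∀ i, L i w = c i • w := by
  induction n using Nat.strong_induction_on with
  | _ n ih =>
  intro V _ _ _ L hL hn hodd
  have hpos : 0 < n := hodd.pos
  have : Nontrivial V := Module.nontrivial_of_finrank_pos (R := ℝ) (by omega)
  by_cases hs : ∀ i, ∃ c : ℝ, L i = c • (1 : Module.End ℝ V)
  · choose c hc using hs
    obtain ⟨w, hw⟩ := exists_ne (0 : V)
    exact ⟨w, hw, c, fun i => by simp [hc i]⟩
  push Not at hs
  obtain ⟨i₀, hi₀⟩ := hs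
  obtain ⟨μ, hμ⟩ := Polynomial.exists_isRoot_of_odd_natDegree_real (L i₀).charpoly
    (by rwa [LinearMap.charpoly_natDegree, hn])
  have hev : (L i₀).HasEigenvalue μ := by
    rwa [Module.End.hasEigenvalue_iff_isRoot_charpoly]
  set D : Module.End ℝ V := L i₀ - μ • 1 with hD
  have hcomm : ∀ i, Commute D (L i) := fun i =>
    (hL i₀ i).sub_left ((Commute.one_left _).smul_left μ)
  have hker : LinearMap.ker D ≠ ⊥ := by
    have := hev.exists_hasEigenvector
    obtain ⟨v, hv⟩ := this
    intro hbot
    refine hv.2 ?_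
    have : v ∈ LinearMap.ker D := by simp [hD, hv.apply_eq_smul]
    rw [hbot] at this
    simpa using this
  have hker' : LinearMap.ker D ≠ ⊤ := by
    intro h
    apply hi₀ μ
    rw [LinearMap.ker_eq_top] at h
    rwa [hD, sub_eq_zero] at h
  have hsum := LinearMap.finrank_range_add_finrank_ker D
  have h1 : Module.finrank ℝ (LinearMap.ker D) < n := hn ▸ Submodule.finrank_lt hker'
  have h0 : 0 < Module.finrank ℝ (LinearMap.ker D) := by
    rw [Module.finrank_pos_iff]
    exact Submodule.nontrivial_iff_ne_bot.2 hker
  have key : ∀ W : Submodule ℝ V, (∀ i, ∀ x ∈ W, L i x ∈ W) → Module.finrank ℝ W < n →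
      Odd (Module.finrank ℝ W) → ∃ w : V, w ≠ 0 ∧ ∃ c : ι → ℝ, ∀ i, L i w = c i • w := by
    intro W hW hlt hWodd
    obtain ⟨w, hw, c, hc⟩ := ih _ hlt W (fun i => (L i).restrict (hW i))
      (fun i j => by
        ext x
        exact congrArg (fun f : Module.End ℝ V => f x) (hL i j)) rfl hWodd
    refine ⟨w, by simpa using hw, c, fun i => ?_⟩
    simpa using congrArg Subtype.val (hc i)
  rcases Nat.even_or_odd (Module.finrank ℝ (LinearMap.ker D)) with he | ho
  · refine key (LinearMap.range D) ?_ (by omega) ?_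
    · rintro i _ ⟨x, rfl⟩
      exact ⟨L i x, congrArg (fun f : Module.End ℝ V => f x) (hcomm i)⟩
    · have : Odd (Module.finrank ℝ (LinearMap.range D) + Module.finrank ℝ (LinearMap.ker D)) := by
        rw [hsum, hn]; exact hodd
      exact (Nat.odd_add.1 this).2 he
  · refine key (LinearMap.ker D) ?_ h1 ho
    intro i x hx
    rw [LinearMap.mem_ker] at hx ⊢
    have := congrArg (fun f : Module.End ℝ V => f x) (hcomm i)
    simp only [Module.End.mul_apply] at this
    rw [this, hx, map_zero]

namespace MvPolynomial

variable {σ : Type} {w : σ → ℕ}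

/-- The polynomials all of whose monomials have weight less than `n`. -/
noncomputable def weightLT (w : σ → ℕ) (n : ℕ) : Submodule ℝ (MvPolynomial σ ℝ) :=
  restrictSupport ℝ {m | Finsupp.weight w m < n}

theorem weightLT_mono {a b : ℕ} (h : a ≤ b) : weightLT w a ≤ weightLT w b :=
  restrictSupport_mono ℝ fun _ hm => lt_of_lt_of_le hm h

theorem mul_mem_weightLT {a b : ℕ} {p q : MvPolynomial σ ℝ} (hp : p ∈ weightLT w a)
    (hq : q ∈ weightLT w (b + 1)) : p * q ∈ weightLT w (a + b) := by
  have : p * q ∈ weightLT w a * weightLT w (b + 1) := Submodule.mul_mem_mul hp hq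
  rw [weightLT, weightLT, ← restrictSupport_add] at this
  refine restrictSupport_mono ℝ ?_ this
  rintro _ ⟨m, hm, m', hm', rfl⟩
  simp only [Set.mem_ofPred_eq, map_add] at *
  omega

/-- `p` has leading monomial `m` with coefficient `1`, with respect to the weights `w`. -/
def HasLeadingMonomial (w : σ → ℕ) (p : MvPolynomial σ ℝ) (m : σ →₀ ℕ) : Prop :=
  p - monomial m 1 ∈ weightLT w (Finsupp.weight w m)

theorem hasLeadingMonomial_monomial (m : σ →₀ ℕ) :
    HasLeadingMonomial w (monomial m 1) m := by
  simp [HasLeadingMonomial]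

theorem HasLeadingMonomial.mem_weightLT {p : MvPolynomial σ ℝ} {m : σ →₀ ℕ}
    (hp : HasLeadingMonomial w p m) : p ∈ weightLT w (Finsupp.weight w m + 1) := by
  have h : monomial m (1 : ℝ) ∈ weightLT w (Finsupp.weight w m + 1) := by
    rw [weightLT, monomial_mem_restrictSupport]; left; simp
  simpa using add_mem (weightLT_mono (Nat.le_succ _) hp) h

theorem HasLeadingMonomial.mul {p q : MvPolynomial σ ℝ} {m m' : σ →₀ ℕ}
    (hp : HasLeadingMonomial w p m) (hq : HasLeadingMonomial w q m') :
    HasLeadingMonomial w (p * q) (m + m') := by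
  have h1 := mul_mem_weightLT hp hq.mem_weightLT
  have h2 := mul_mem_weightLT hq (hasLeadingMonomial_monomial (w := w) m).mem_weightLT
  have h : p * q - monomial (m + m') 1 =
      (p - monomial m 1) * q + (q - monomial m' 1) * monomial m 1 := by
    have : monomial (m + m') (1 : ℝ) = monomial m 1 * monomial m' 1 := by
      rw [monomial_mul, mul_one]
    rw [this]; ring
  rw [HasLeadingMonomial, h, map_add]
  rw [add_comm (Finsupp.weight w m')] at h2
  exact add_mem h1 h2

theorem HasLeadingMonomial.pow {p : MvPolynomial σ ℝ} {m : σ →₀ ℕ}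
    (hp : HasLeadingMonomial w p m) (n : ℕ) : HasLeadingMonomial w (p ^ n) (n • m) := by
  induction n with
  | zero => simpa using hasLeadingMonomial_monomial (w := w) 0
  | succ n ih => rw [pow_succ, succ_nsmul]; exact ih.mul hp

theorem HasLeadingMonomial.prod {ι : Type*} (s : Finset ι) {p : ι → MvPolynomial σ ℝ}
    {m : ι → σ →₀ ℕ} (hp : ∀ i ∈ s, HasLeadingMonomial w (p i) (m i)) :
    HasLeadingMonomial w (∏ i ∈ s, p i) (∑ i ∈ s, m i) := by
  classical
  induction s using Finset.induction_on with
  | empty => simpa using hasLeadingMonomial_monomial (w := w) 0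
  | insert a s ha ih =>
    rw [Finset.prod_insert ha, Finset.sum_insert ha]
    exact (hp a (Finset.mem_insert_self _ _)).mul
      (ih fun i hi => hp i (Finset.mem_insert_of_mem hi))

/-- A linear endomorphism which is unipotent with respect to the weight filtration is bijective. -/
theorem bijective_of_sub_mem_weightLT (T : MvPolynomial σ ℝ →ₗ[ℝ] MvPolynomial σ ℝ)
    (hT : ∀ m, HasLeadingMonomial w (T (monomial m 1)) m) : Function.Bijective T := by
  have hD : ∀ n, ∀ p ∈ weightLT w (n + 1), T p - p ∈ weightLT w n := by
    intro n p hp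
    rw [weightLT, restrictSupport_eq_span] at hp
    induction hp using Submodule.span_induction with
    | mem x hx =>
      obtain ⟨m, hm, rfl⟩ := hx
      exact weightLT_mono (Nat.lt_succ_iff.1 hm) (hT m)
    | zero => simp
    | add x y _ _ hx hy =>
      have : T (x + y) - (x + y) = (T x - x) + (T y - y) := by rw [map_add]; ring
      rw [this]; exact add_mem hx hy
    | smul a x _ hx =>
      rw [map_smul, ← smul_sub]; exact Submodule.smul_mem _ _ hx
  have h0 : ∀ p ∈ weightLT w 0, p = 0 := by
    intro p hp
    rw [weightLT, mem_restrictSupport_iff] at hp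
    simpa using hp
  have hex : ∀ p : MvPolynomial σ ℝ, ∃ n, p ∈ weightLT w n := by
    intro p
    refine ⟨p.support.sup (Finsupp.weight w) + 1, ?_⟩
    intro m hm
    exact Nat.lt_succ_of_le (Finset.le_sup (f := Finsupp.weight w) hm)
  constructor
  · refine (injective_iff_map_eq_zero T).2 fun p hp => ?_
    obtain ⟨n, hn⟩ := hex p
    induction n with
    | zero => exact h0 p hn
    | succ n ih =>
      apply ih
      have := hD n p hn
      rw [hp, zero_sub] at this
      simpa using this
  · intro p
    obtain ⟨n, hn⟩ := hex p
    induction n generalizing p with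
    | zero => exact ⟨0, by rw [h0 p hn, map_zero]⟩
    | succ n ih =>
      obtain ⟨q, hq⟩ := ih _ (hD n p hn)
      exact ⟨p - q, by rw [map_sub, hq]; ring⟩

section Subst

variable [Fintype σ] {e : σ → ℕ} {g : σ → MvPolynomial σ ℝ}

/-- The product of the powers of the `g i` and of the remaining variables replacing the monomial
`m` when `X i ^ e i` is replaced by `g i`. -/
noncomputable def substMonomial (e : σ → ℕ) (g : σ → MvPolynomial σ ℝ) (m : σ →₀ ℕ) :
    MvPolynomial σ ℝ :=
  ∏ i, X i ^ (m i % e i) * g i ^ (m i / e i)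

/-- The linear map sending a monomial `m` to `substMonomial e g m`. -/
noncomputable def substLinear (e : σ → ℕ) (g : σ → MvPolynomial σ ℝ) :
    MvPolynomial σ ℝ →ₗ[ℝ] MvPolynomial σ ℝ :=
  (basisMonomials σ ℝ).constr ℝ (substMonomial e g)

@[simp]
theorem substLinear_monomial (m : σ →₀ ℕ) :
    substLinear e g (monomial m 1) = substMonomial e g m := by
  have := (basisMonomials σ ℝ).constr_basis ℝ (substMonomial e g) m
  rwa [coe_basisMonomials] at this

theorem substLinear_bijective (w : σ → ℕ)
    (hg : ∀ i, HasLeadingMonomial w (g i) (Finsupp.single i (e i))) :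
    Function.Bijective (substLinear e g) := by
  classical
  apply bijective_of_sub_mem_weightLT (w := w)
  intro m
  rw [substLinear_monomial, substMonomial]
  have h : HasLeadingMonomial w (∏ i, X i ^ (m i % e i) * g i ^ (m i / e i))
      (∑ i, ((m i % e i) • Finsupp.single i 1 + (m i / e i) • Finsupp.single i (e i))) :=
    HasLeadingMonomial.prod _ fun i _ =>
      ((hasLeadingMonomial_monomial (Finsupp.single i 1)).pow _).mul ((hg i).pow _)
  convert! h using 1
  ext j
  rw [Finsupp.finsetSum_apply, Finset.sum_eq_single j]
  · simp [Nat.mod_add_div']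
  · intro i _ hij
    simp [hij]
  · simp

/-- The exponents not divisible by any `X i ^ e i`. -/
def box (e : σ → ℕ) : Set (σ →₀ ℕ) := {m | ∀ i, m i < e i}

theorem substMonomial_of_mem_box {m : σ →₀ ℕ} (hm : m ∈ box e) :
    substMonomial e g m = monomial m 1 := by
  classical
  rw [substMonomial, monomial_eq, Finsupp.prod_fintype _ _ (by simp), map_one, one_mul]
  refine Finset.prod_congr rfl fun i _ => ?_
  rw [Nat.mod_eq_of_lt (hm i), Nat.div_eq_of_lt (hm i), pow_zero, mul_one]

theorem substMonomial_mul (he : ∀ i, 0 < e i) (m : σ →₀ ℕ) (i : σ) :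
    substMonomial e g (m + Finsupp.single i (e i)) = substMonomial e g m * g i := by
  classical
  have : g i = ∏ j, if j = i then g j else 1 := by simp
  rw [substMonomial, substMonomial, this, ← Finset.prod_mul_distrib]
  refine Finset.prod_congr rfl fun j _ => ?_
  by_cases hj : j = i
  · subst hj
    simp [Nat.add_div_right _ (he j), pow_succ, mul_assoc]
  · simp [hj]

theorem substLinear_of_mem_box {p : MvPolynomial σ ℝ} (hp : p ∈ restrictSupport ℝ (box e)) :
    substLinear e g p = p := by
  rw [restrictSupport_eq_span] at hp
  induction hp using Submodule.span_induction with
  | mem x hx =>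
    obtain ⟨m, hm, rfl⟩ := hx
    rw [substLinear_monomial, substMonomial_of_mem_box hm]
  | zero => simp
  | add x y _ _ hx hy => rw [map_add, hx, hy]
  | smul a x _ hx => rw [map_smul, hx]

/-- The ideal generated by the `g i` corresponds to the monomials outside the box. -/
theorem mem_span_range_iff (w : σ → ℕ) (he : ∀ i, 0 < e i)
    (hg : ∀ i, HasLeadingMonomial w (g i) (Finsupp.single i (e i))) (p : MvPolynomial σ ℝ) :
    substLinear e g p ∈ Ideal.span (Set.range g) ↔ p ∈ restrictSupport ℝ (box e)ᶜ := by
  classical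
  have hbij := substLinear_bijective w hg
  constructor
  · have key : ∀ q ∈ Ideal.span (Set.range g),
        q ∈ (restrictSupport ℝ (box e)ᶜ).map (substLinear e g) := by
      intro q hq
      induction hq using Submodule.span_induction with
      | mem x hx =>
        obtain ⟨i, rfl⟩ := hx
        refine ⟨monomial (Finsupp.single i (e i)) 1, ?_, ?_⟩
        · refine (monomial_mem_restrictSupport ℝ).2 (Or.inl fun h => ?_)
          simpa using h i
        · have := substMonomial_mul (g := g) he 0 i
          rw [zero_add, substMonomial_of_mem_box (e := e) (g := g) (m := 0)
            (fun i => by simpa using he i)] at this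
          rw [substLinear_monomial, this]
          simp
      | zero => exact zero_mem _
      | add x y _ _ hx hy => exact add_mem hx hy
      | smul a x hxI hx =>
        clear hxI
        obtain ⟨q, hq, rfl⟩ := hx
        rw [smul_eq_mul, mul_comm]
        revert a
        suffices h : ∀ a i, substLinear e g a * g i ∈
            (restrictSupport ℝ (box e)ᶜ).map (substLinear e g) by
          intro a
          rw [SetLike.mem_coe, restrictSupport_eq_span] at hq
          induction hq using Submodule.span_induction generalizing a with
          | mem x hx =>
            obtain ⟨m, hm, rfl⟩ := hx
            obtain ⟨i, hi⟩ : ∃ i, e i ≤ m i := by simpa [box] using hm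
            have hm' : m = (m - Finsupp.single i (e i)) + Finsupp.single i (e i) := by
              rw [tsub_add_cancel_of_le]
              simpa using hi
            rw [substLinear_monomial, hm', substMonomial_mul he]
            obtain ⟨b, hb⟩ := hbij.2 (a * substMonomial e g (m - Finsupp.single i (e i)))
            have := h b i
            rw [hb] at this
            convert! this using 1
            ring
          | zero => simp
          | add x y _ _ hx hy => rw [map_add, add_mul]; exact add_mem (hx a) (hy a)
          | smul c x _ hx =>
            rw [map_smul, smul_mul_assoc]; exact Submodule.smul_mem _ _ (hx a)
        intro a i
        induction a using MvPolynomial.induction_on' with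
        | monomial u c =>
          have : monomial u c = c • monomial u (1 : ℝ) := by simp [smul_monomial]
          rw [this, map_smul, smul_mul_assoc, substLinear_monomial, ← substMonomial_mul he]
          refine Submodule.smul_mem _ _ ⟨_, ?_, substLinear_monomial _⟩
          refine (monomial_mem_restrictSupport ℝ).2 (Or.inl fun h => ?_)
          simpa using h i
        | add p q hp hq => rw [map_add, add_mul]; exact add_mem hp hq
    intro h
    obtain ⟨q, hq, hqp⟩ := key _ h
    exact hbij.1 hqp ▸ hq
  · intro hp
    rw [restrictSupport_eq_span] at hp
    induction hp using Submodule.span_induction with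
    | mem x hx =>
      obtain ⟨m, hm, rfl⟩ := hx
      obtain ⟨i, hi⟩ : ∃ i, e i ≤ m i := by simpa [box] using hm
      have hm' : m = (m - Finsupp.single i (e i)) + Finsupp.single i (e i) := by
        rw [tsub_add_cancel_of_le]
        simpa using hi
      rw [substLinear_monomial, hm', substMonomial_mul he]
      exact Ideal.mul_mem_left _ _ (Ideal.subset_span ⟨i, rfl⟩)
    | zero => simp
    | add x y _ _ hx hy => rw [map_add]; exact add_mem hx hy
    | smul a x _ hx =>
      rw [map_smul, Algebra.smul_def]
      exact Ideal.mul_mem_left _ _ hx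

end Subst

/-- The algebra endomorphism `p(x) ↦ p(-x)`. -/
noncomputable def negVars (σ : Type) : MvPolynomial σ ℝ →ₐ[ℝ] MvPolynomial σ ℝ :=
  aeval fun i => -X i

@[simp]
theorem negVars_X (i : σ) : negVars σ (X i) = -X i := by simp [negVars]

@[simp]
theorem negVars_monomial (m : σ →₀ ℕ) (c : ℝ) :
    negVars σ (monomial m c) = monomial m ((-1) ^ m.degree * c) := by
  rw [negVars, aeval_monomial, monomial_eq, map_mul, Finsupp.degree_apply,
    ← Finset.prod_pow_eq_pow_sum,
    Finsupp.prod, Finsupp.prod, algebraMap_eq]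
  simp only [neg_pow (X _ : MvPolynomial σ ℝ)]
  rw [Finset.prod_mul_distrib]
  simp only [map_prod, map_pow, map_neg, map_one]
  ring

theorem coeff_negVars (p : MvPolynomial σ ℝ) (m : σ →₀ ℕ) :
    coeff m (negVars σ p) = (-1) ^ m.degree * coeff m p := by
  classical
  induction p using MvPolynomial.induction_on' with
  | monomial u c =>
    rw [negVars_monomial, coeff_monomial, coeff_monomial]
    split_ifs with h
    · rw [h]
    · simp
  | add p q hp hq => rw [map_add, coeff_add, coeff_add, hp, hq]; ring

theorem eval_negVars (p : MvPolynomial σ ℝ) (x : σ → ℝ) :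
    eval x (negVars σ p) = eval (-x) p := by
  induction p using MvPolynomial.induction_on with
  | C a => simp [negVars]
  | add p q hp hq => simp [hp, hq]
  | mul_X p i hp => simp [hp]

theorem mem_restrictSupport_even {s : Set (σ →₀ ℕ)} {p : MvPolynomial σ ℝ} :
    p ∈ restrictSupport ℝ (s ∩ {m | Even m.degree}) ↔
      p ∈ restrictSupport ℝ s ∧ negVars σ p = p := by
  rw [mem_restrictSupport_iff, mem_restrictSupport_iff, Set.subset_inter_iff]
  refine and_congr_right fun _ => ?_
  constructor
  · intro h
    ext m
    rw [coeff_negVars]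
    by_cases hm : m ∈ p.support
    · have : Even m.degree := h hm
      rw [this.neg_one_pow, one_mul]
    · rw [notMem_support_iff.1 hm, mul_zero]
  · intro h m hm
    by_contra hodd
    have h1 := coeff_negVars p m
    rw [h, (Nat.not_even_iff_odd.1 hodd).neg_one_pow] at h1
    exact mem_support_iff.1 hm (by linarith)

section Parity

variable [Fintype σ] {e : σ → ℕ} {g : σ → MvPolynomial σ ℝ}

theorem negVars_substLinear (hg : ∀ i, negVars σ (g i) = (-1) ^ e i * g i)
    (p : MvPolynomial σ ℝ) :
    negVars σ (substLinear e g p) = substLinear e g (negVars σ p) := by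
  induction p using MvPolynomial.induction_on' with
  | monomial u c =>
    have h : ∀ c : ℝ, monomial u c = c • monomial u (1 : ℝ) := fun c => by simp [smul_monomial]
    rw [negVars_monomial, h c, h (_ * c), map_smul, map_smul, map_smul, substLinear_monomial,
      mul_comm, mul_smul]
    congr 1
    rw [substMonomial, map_prod, Finsupp.degree_eq_sum, ← Finset.prod_pow_eq_pow_sum,
      Algebra.smul_def, map_prod, ← Finset.prod_mul_distrib]
    refine Finset.prod_congr rfl fun i _ => ?_
    have hpow : algebraMap ℝ (MvPolynomial σ ℝ) ((-1) ^ u i) =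
        (-1) ^ (u i % e i) * (-1) ^ (e i * (u i / e i)) := by
      rw [← pow_add, Nat.mod_add_div]; simp
    rw [map_mul, map_pow, map_pow, negVars_X, hg, neg_pow, mul_pow, ← pow_mul, hpow]
    ring
  | add p q hp hq => simp [hp, hq]

/-- The number of exponents of even degree in the box is odd if one side of the box has length two
and the others are odd. -/
theorem odd_card_even_box {N E : ℕ} (hE : Odd E) :
    Odd (Nat.card ↥(box (Fin.cons 2 fun _ => E : Fin (N + 1) → ℕ) ∩ {m | Even m.degree})) := by
  have : ↥(box (Fin.cons 2 fun _ => E : Fin (N + 1) → ℕ) ∩ {m | Even m.degree}) ≃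
      (Fin N → Fin E) :=
    { toFun := fun m i => ⟨m.1 i.succ, by simpa using m.2.1 i.succ⟩
      invFun := fun f => ⟨Finsupp.equivFunOnFinite.symm
          (Fin.cons ((∑ i, (f i : ℕ)) % 2) fun i => (f i : ℕ)), by
        constructor
        · intro i
          refine Fin.cases ?_ (fun i => ?_) i
          · simpa using Nat.mod_lt _ two_pos
          · simp
        · simp only [Set.mem_ofPred_eq, Finsupp.degree_eq_sum, Fin.sum_univ_succ,
            Finsupp.equivFunOnFinite_symm_apply_apply, Fin.cons_zero, Fin.cons_succ]
          rw [Nat.even_iff]; omega⟩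
      left_inv := by
        rintro ⟨m, hm, he⟩
        ext i
        refine Fin.cases ?_ (fun i => ?_) i
        · have h0 : m 0 < 2 := by simpa using hm 0
          simp only [Set.mem_ofPred_eq, Finsupp.degree_eq_sum, Fin.sum_univ_succ,
            Nat.even_iff] at he
          simp
          omega
        · simp
      right_inv := by
        intro f
        ext i
        simp }
  rw [Nat.card_congr this]
  simpa using hE.pow

end Parity

/-- A vector which is an eigenvector of all products of two variables gives rise to a common
eigenvector of the variables. -/
theorem exists_eigenvector_of_mul_eigenvector {σ R : Type*} [Fintype σ] [CommRing R] [Algebra ℝ R]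
    (ξ : σ → R) {W : R} (hW : W ≠ 0) (Y : σ → σ → ℝ) (hY : ∀ i j, ξ i * ξ j * W = Y i j • W)
    (hsum : ∑ i, Y i i = 1) : ∃ (v : σ → ℝ) (Z : R), Z ≠ 0 ∧ ∀ i, ξ i * Z = v i • Z := by
  obtain ⟨k, hk⟩ : ∃ k, 0 < Y k k := by
    by_contra! h
    have := Finset.sum_nonpos fun i (_ : i ∈ Finset.univ) => h i
    linarith
  have hX : ∀ c : ℝ, c ≠ 0 → c ^ 2 = Y k k → ∀ i, ξ i * (ξ k * W + c • W) =
      (Y i k / c) • (ξ k * W + c • W) := by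
    intro c hc hck i
    have h1 : c ^ 2 • (ξ i * W) = Y i k • (ξ k * W) := by
      have h2 : ξ i * (ξ k * ξ k * W) = ξ k * (ξ i * ξ k * W) := by ring
      rw [hY, hY, mul_smul_comm, mul_smul_comm, ← hck] at h2
      exact h2
    have h2 : ξ i * W = (Y i k / c ^ 2) • (ξ k * W) := by
      rw [div_eq_inv_mul, mul_smul, ← h1, smul_smul, inv_mul_cancel₀ (pow_ne_zero 2 hc), one_smul]
    rw [mul_add, ← mul_assoc, hY, mul_smul_comm, h2, smul_add, smul_smul, smul_smul, add_comm]
    congr 2 <;> field_simp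
  have hs := Real.sqrt_pos.2 hk
  by_cases hZ : ξ k * W + Real.sqrt (Y k k) • W = 0
  · refine ⟨_, _, ?_, hX (-Real.sqrt (Y k k)) (by simpa using hs.ne')
      (by rw [neg_sq, Real.sq_sqrt hk.le])⟩
    intro h
    have h2 : (2 * Real.sqrt (Y k k)) • W = 0 := by
      rw [← sub_self (0 : R)]
      nth_rewrite 1 [← hZ]
      rw [← h]
      module
    rcases smul_eq_zero.1 h2 with h | h
    · exact absurd h (by positivity)
    · exact hW h
  · exact ⟨_, _, hZ, hX _ hs.ne' (Real.sq_sqrt hk.le)⟩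

/-- The images of the even polynomials in the quotient by a triangular system of definite parity
form a subspace whose dimension is the number of even exponents in the box. -/
theorem exists_finrank_eq_even_box {σ : Type} [Fintype σ] {e : σ → ℕ}
    {g : σ → MvPolynomial σ ℝ} (w : σ → ℕ) (he : ∀ i, 0 < e i)
    (hg : ∀ i, HasLeadingMonomial w (g i) (Finsupp.single i (e i)))
    (hneg : ∀ i, negVars σ (g i) = (-1) ^ e i * g i)
    {R : Type} [CommRing R] [Algebra ℝ R] (mk : MvPolynomial σ ℝ →ₐ[ℝ] R)
    (hmk0 : ∀ p, mk p = 0 ↔ p ∈ Ideal.span (Set.range g)) :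
    ∃ A : Submodule ℝ R, Module.finrank ℝ A = Nat.card ↥(box e ∩ {m | Even m.degree}) ∧
      (∀ p, negVars σ p = p → mk p ∈ A) ∧ ∀ a ∈ A, ∃ p, negVars σ p = p ∧ mk p = a := by
  classical
  have hbij := substLinear_bijective w hg
  let V : Submodule ℝ (MvPolynomial σ ℝ) := restrictSupport ℝ (box e ∩ {m | Even m.degree})
  let A : Submodule ℝ R := V.map mk.toLinearMap
  have hVinj : Function.Injective (mk.toLinearMap.domRestrict V) := by
    refine (injective_iff_map_eq_zero _).2 ?_
    rintro ⟨p, hp⟩ h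
    have hpbox := (mem_restrictSupport_even.1 hp).1
    have hpI : p ∈ Ideal.span (Set.range g) := (hmk0 p).1 h
    rw [← substLinear_of_mem_box (g := g) hpbox, mem_span_range_iff w he hg] at hpI
    ext m
    rw [mem_restrictSupport_iff] at hpbox hpI
    by_cases hm : m ∈ p.support
    · exact absurd (hpbox hm) (hpI hm)
    · simpa using hm
  have hAV : Module.finrank ℝ A = Nat.card ↥(box e ∩ {m | Even m.degree}) := by
    have h1 : A = LinearMap.range (mk.toLinearMap.domRestrict V) := by
      rw [LinearMap.range_domRestrict]
    rw [h1, LinearMap.finrank_range_of_inj hVinj]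
    exact Module.finrank_eq_nat_card_basis (basisRestrictSupport ℝ _)
  have hAeven : ∀ p, negVars σ p = p → mk p ∈ A := by
    intro p hp
    obtain ⟨q, rfl⟩ := hbij.2 p
    rw [negVars_substLinear hneg] at hp
    have hq := hbij.1 hp
    have hsplit : q ∈ restrictSupport ℝ (box e) ⊔ restrictSupport ℝ (box e)ᶜ := by
      have : restrictSupport ℝ (box e) ⊔ restrictSupport ℝ (box e)ᶜ = ⊤ := by
        rw [restrictSupport_eq_span, restrictSupport_eq_span, ← Submodule.span_union,
          ← Set.image_union, Set.union_compl_self, ← restrictSupport_eq_span,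
          restrictSupport_univ]
      rw [this]; trivial
    obtain ⟨a, ha, b, hb, rfl⟩ := Submodule.mem_sup.1 hsplit
    have haeven : negVars σ a = a := by
      ext m
      have := congrArg (coeff m) hq
      rw [map_add, coeff_add, coeff_add, coeff_negVars, coeff_negVars] at this
      rw [coeff_negVars]
      by_cases hm : m ∈ a.support
      · have hmb : coeff m b = 0 := by
          by_contra h
          exact ((mem_restrictSupport_iff ℝ).1 hb (mem_support_iff.2 h))
            ((mem_restrictSupport_iff ℝ).1 ha hm)
        simpa [hmb] using this
      · rw [notMem_support_iff.1 hm, mul_zero]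
    refine ⟨a, mem_restrictSupport_even.2 ⟨ha, haeven⟩, ?_⟩
    have hbI : mk (substLinear e g b) = 0 := (hmk0 _).2 ((mem_span_range_iff w he hg b).2 hb)
    rw [map_add, map_add, hbI, add_zero, substLinear_of_mem_box ha]
    rfl
  refine ⟨A, hAV, hAeven, ?_⟩
  rintro _ ⟨a, ha, rfl⟩
  exact ⟨a, (mem_restrictSupport_even.1 ha).2, rfl⟩

/-- A system of real polynomials in triangular form whose parities are those of its leading
exponents has a real zero as soon as the number of even exponents in its box is odd. -/
theorem exists_real_zero_of_odd_card_of_ker {σ : Type} [Fintype σ] {e : σ → ℕ}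
    {g : σ → MvPolynomial σ ℝ} (w : σ → ℕ) (he : ∀ i, 0 < e i)
    (hg : ∀ i, HasLeadingMonomial w (g i) (Finsupp.single i (e i)))
    (hneg : ∀ i, negVars σ (g i) = (-1) ^ e i * g i)
    (hcard : Odd (Nat.card ↥(box e ∩ {m | Even m.degree})))
    (hsq : ∑ i, (X i : MvPolynomial σ ℝ) ^ 2 - 1 ∈ Ideal.span (Set.range g))
    {R : Type} [CommRing R] [Algebra ℝ R] (mk : MvPolynomial σ ℝ →ₐ[ℝ] R)
    (hmk0' : ∀ p, mk p = 0 ↔ p ∈ Ideal.span (Set.range g)) :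
    ∃ v : σ → ℝ, ∀ i, eval v (g i) = 0 := by
  classical
  obtain ⟨A, hAV, hAeven, hAex⟩ := exists_finrank_eq_even_box w he hg hneg mk hmk0'
  have hmk0 : ∀ p, p ∈ Ideal.span (Set.range g) → mk p = 0 := fun p => (hmk0' p).2
  have hAfin : FiniteDimensional ℝ A := Module.finite_of_finrank_pos (hAV ▸ hcard.pos)
  have hmul : ∀ ij : σ × σ, ∀ a ∈ A, LinearMap.mulLeft ℝ (mk (X ij.1 * X ij.2)) a ∈ A := by
    rintro ⟨i, j⟩ a ha
    obtain ⟨p, hp, rfl⟩ := hAex a ha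
    have h := hAeven (X i * X j * p) (by simp [hp])
    simpa [mul_assoc] using h
  let L : σ × σ → Module.End ℝ A := fun ij =>
    (LinearMap.mulLeft ℝ (mk (X ij.1 * X ij.2))).restrict (hmul ij)
  have hL : ∀ ij x, (L ij x : R) = mk (X ij.1 * X ij.2) * x := fun _ _ => rfl
  have hcomm : ∀ ij kl, Commute (L ij) (L kl) := by
    intro ij kl
    refine LinearMap.ext fun x => Subtype.ext ?_
    rw [Module.End.mul_apply, Module.End.mul_apply, hL, hL, hL, hL]
    exact mul_left_comm _ _ _
  obtain ⟨W', hW', Y, hY'⟩ := exists_common_eigenvector_of_odd_finrank _ A L hcomm hAV hcard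
  have hW : (W' : R) ≠ 0 := fun h => hW' (Subtype.ext h)
  have hY : ∀ i j, mk (X i) * mk (X j) * (W' : R) = Y (i, j) • (W' : R) := by
    intro i j
    have h := congrArg Subtype.val (hY' (i, j))
    rw [hL, map_mul] at h
    exact h
  generalize (W' : R) = W at hW hY
  have hsum : ∑ i, Y (i, i) = 1 := by
    have h1 : mk (∑ i, X i ^ 2 - 1) * W = 0 := by rw [hmk0 _ hsq, zero_mul]
    rw [map_sub, map_sum, map_one, sub_mul, one_mul, Finset.sum_mul, sub_eq_zero] at h1
    have h2 : ∑ i, mk (X i ^ 2) * W = (∑ i, Y (i, i)) • W := by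
      rw [Finset.sum_smul]
      refine Finset.sum_congr rfl fun i _ => ?_
      rw [← hY, map_pow, sq]
    rw [h2] at h1
    have h3 : (∑ i, Y (i, i) - 1) • W = 0 := by rw [sub_smul, h1, one_smul, sub_self]
    rcases smul_eq_zero.1 h3 with h | h
    · linarith
    · exact absurd h hW
  obtain ⟨v, Z, hZ, hX⟩ := exists_eigenvector_of_mul_eigenvector (fun i => mk (X i)) hW
    (fun i j => Y (i, j)) hY hsum
  have hall : ∀ p, mk p * Z = eval v p • Z := by
    intro p
    induction p using MvPolynomial.induction_on with
    | C a =>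
      have : mk (C a) = algebraMap ℝ _ a := mk.commutes a
      rw [this, eval_C, Algebra.smul_def]
    | add p q hp hq => rw [map_add, add_mul, hp, hq, map_add, add_smul]
    | mul_X p i hp =>
      rw [map_mul, mul_assoc, hX, mul_smul_comm, hp, smul_smul, map_mul, eval_X, mul_comm]
  refine ⟨v, fun i => ?_⟩
  have := hall (g i)
  rw [hmk0 _ (Ideal.subset_span ⟨i, rfl⟩), zero_mul, eq_comm, smul_eq_zero] at this
  exact this.resolve_right hZ

/-- A system of real polynomials in triangular form whose parities are those of its leading
exponents has a real zero as soon as the number of even exponents in its box is odd. -/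
theorem exists_real_zero_of_odd_card {σ : Type} [Fintype σ] {e : σ → ℕ}
    {g : σ → MvPolynomial σ ℝ} (w : σ → ℕ) (he : ∀ i, 0 < e i)
    (hg : ∀ i, HasLeadingMonomial w (g i) (Finsupp.single i (e i)))
    (hneg : ∀ i, negVars σ (g i) = (-1) ^ e i * g i)
    (hcard : Odd (Nat.card ↥(box e ∩ {m | Even m.degree})))
    (hsq : ∑ i, (X i : MvPolynomial σ ℝ) ^ 2 - 1 ∈ Ideal.span (Set.range g)) :
    ∃ v : σ → ℝ, ∀ i, eval v (g i) = 0 :=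
  exists_real_zero_of_odd_card_of_ker w he hg hneg hcard hsq
    (Ideal.Quotient.mkₐ ℝ (Ideal.span (Set.range g))) fun _ => Ideal.Quotient.eq_zero_iff_mem

/-- Odd polynomials in `N + 1` variables have approximate common zeros on the sphere if their
number is `N`. -/
theorem exists_approx_zero_on_sphere {N : ℕ} (f : Fin N → MvPolynomial (Fin (N + 1)) ℝ)
    (hf : ∀ i, negVars _ (f i) = -f i) {t : ℝ} (ht : 0 < t) :
    ∃ v : Fin (N + 1) → ℝ, ∑ i, v i ^ 2 = 1 ∧ ∀ i, |eval v (f i)| ≤ t := by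
  classical
  let w : Fin (N + 1) → ℕ := Fin.cons 2 fun _ => 1
  let D : ℕ := Finset.univ.sup fun i => weightedTotalDegree w (f i)
  let E : ℕ := 2 * D + 1
  let e : Fin (N + 1) → ℕ := Fin.cons 2 fun _ => E
  let g : Fin (N + 1) → MvPolynomial (Fin (N + 1)) ℝ :=
    Fin.cons (∑ i, X i ^ 2 - 1) fun i => X i.succ ^ E + C t⁻¹ * f i
  have hE : Odd E := odd_two_mul_add_one D
  have hmon : ∀ (i : Fin (N + 1)) (n : ℕ), (X i : MvPolynomial (Fin (N + 1)) ℝ) ^ n =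
      monomial (Finsupp.single i n) 1 := fun i n => X_pow_eq_monomial
  have he : ∀ i, 0 < e i := by
    intro i
    refine Fin.cases ?_ (fun i => ?_) i
    · simp [e]
    · simpa [e] using hE.pos
  have hg : ∀ i, HasLeadingMonomial w (g i) (Finsupp.single i (e i)) := by
    intro i
    refine Fin.cases ?_ (fun i => ?_) i
    · simp only [g, e, Fin.cons_zero, HasLeadingMonomial]
      rw [← hmon, Fin.sum_univ_succ]
      have : ∀ a b : MvPolynomial (Fin (N + 1)) ℝ, a + b - 1 - a = b - 1 := fun a b => by ring
      rw [this]
      refine sub_mem (sum_mem fun i _ => ?_) ?_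
      · rw [hmon, weightLT, monomial_mem_restrictSupport]
        left
        simp [Finsupp.weight_single, w]
      · rw [← C_1, C_apply, weightLT, monomial_mem_restrictSupport]
        left
        simp [Finsupp.weight_single, w]
    · simp only [g, e, Fin.cons_succ, HasLeadingMonomial]
      rw [← hmon, add_sub_cancel_left, ← smul_eq_C_mul]
      refine Submodule.smul_mem _ _ ?_
      rw [weightLT, mem_restrictSupport_iff]
      intro m hm
      have h1 := le_weightedTotalDegree w (Finset.mem_coe.1 hm)
      have h2 : weightedTotalDegree w (f i) ≤ D :=
        Finset.le_sup (f := fun i => weightedTotalDegree w (f i)) (Finset.mem_univ i)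
      simp only [Set.mem_ofPred_eq, Finsupp.weight_single, w, Fin.cons_succ, smul_eq_mul]
      simp only [w] at h1 h2
      omega
  have hneg : ∀ i, negVars _ (g i) = (-1) ^ e i * g i := by
    intro i
    refine Fin.cases ?_ (fun i => ?_) i
    · simp [g, e]
    · simp only [g, e, Fin.cons_succ, map_add, map_mul, map_pow, negVars_X, hf, hE.neg_one_pow,
        hE.neg_pow]
      have : negVars (Fin (N + 1)) (C t⁻¹) = C t⁻¹ := by simp [negVars]
      rw [this]
      ring
  obtain ⟨v, hv⟩ := exists_real_zero_of_odd_card (e := e) (g := g) w he hg hneg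
    (odd_card_even_box hE) (Ideal.subset_span ⟨0, rfl⟩)
  have hv0 : ∑ i, v i ^ 2 = 1 := by
    have := hv 0
    simp only [g, Fin.cons_zero] at this
    simp only [map_sub, map_sum, map_pow, eval_X, map_one] at this
    linarith
  refine ⟨v, hv0, fun i => ?_⟩
  have h1 := hv i.succ
  simp only [g, Fin.cons_succ] at h1
  simp only [map_add, map_pow, eval_X, map_mul, eval_C] at h1
  have h2 : eval v (f i) = -(t * v i.succ ^ E) := by field_simp at h1; linarith
  have h3 : |v i.succ| ≤ 1 := by
    rw [← sq_le_one_iff_abs_le_one, ← hv0]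
    exact Finset.single_le_sum (f := fun i => v i ^ 2) (fun i _ => sq_nonneg _)
      (Finset.mem_univ i.succ)
  rw [h2, abs_neg, abs_mul, abs_pow, abs_of_pos ht]
  exact mul_le_of_le_one_right ht.le (pow_le_one₀ (abs_nonneg _) h3)

end MvPolynomial

theorem MvPolynomial.exists_near_on_isCompact {σ : Type} {S : Set (σ → ℝ)}
    (hS : IsCompact S) {f : (σ → ℝ) → ℝ} (hf : ContinuousOn f S) {ε : ℝ} (hε : 0 < ε) :
    ∃ p : MvPolynomial σ ℝ, ∀ x ∈ S, |eval x p - f x| < ε := by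
  have : CompactSpace S := isCompact_iff_compactSpace.1 hS
  let coord : σ → C(S, ℝ) := fun i =>
    ⟨fun x => x.1 i, (continuous_apply i).comp continuous_subtype_val⟩
  have heval (p : MvPolynomial σ ℝ) (x : S) : aeval coord p x = eval x.1 p := by
    induction p using MvPolynomial.induction_on with
    | C a => simp [Algebra.algebraMap_eq_smul_one]
    | add p q hp hq => simp [hp, hq]
    | mul_X p i hp => simp [hp, coord]
  obtain ⟨⟨g, p, rfl⟩, hg⟩ :=
    ContinuousMap.exists_mem_subalgebra_near_continuous_of_separatesPoints
      (aeval (R := ℝ) coord).range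
      (by
        intro x y hxy
        obtain ⟨i, hi⟩ := Function.ne_iff.1 (Subtype.coe_injective.ne hxy)
        exact ⟨coord i, ⟨coord i, ⟨X i, by simp⟩, rfl⟩, hi⟩)
      (S.domRestrict f) hf.domRestrict ε hε
  refine ⟨p, fun x hx => ?_⟩
  have := hg ⟨x, hx⟩
  simpa [heval, Set.domRestrict_apply] using this

theorem isCompact_setOf_sum_sq_eq_one (ι : Type) [Fintype ι] :
    IsCompact {v : ι → ℝ | ∑ i, v i ^ 2 = 1} := by
  refine Metric.isCompact_of_isClosed_isBounded
    (isClosed_eq (by fun_prop) continuous_const) ?_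
  refine (Metric.isBounded_closedBall (x := (0 : ι → ℝ)) (r := 1)).subset fun v hv => ?_
  rw [mem_closedBall_zero_iff, pi_norm_le_iff_of_nonneg zero_le_one]
  intro i
  rw [Real.norm_eq_abs, ← sq_le_one_iff_abs_le_one]
  exact (Finset.single_le_sum (f := fun i => v i ^ 2) (fun i _ => sq_nonneg _)
    (Finset.mem_univ i)).trans hv.le

/-- The **Borsuk–Ulam theorem**: an odd continuous map from the `N`-sphere to `ℝ^N` has a zero. -/
theorem borsuk_ulam {N : ℕ} {h : (Fin (N + 1) → ℝ) → Fin N → ℝ}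
    (hc : ContinuousOn h {v | ∑ i, v i ^ 2 = 1})
    (hodd : ∀ v, ∑ i, v i ^ 2 = 1 → h (-v) = -h v) :
    ∃ v, ∑ i, v i ^ 2 = 1 ∧ h v = 0 := by
  set S : Set (Fin (N + 1) → ℝ) := {v | ∑ i, v i ^ 2 = 1}
  have hS : IsCompact S := isCompact_setOf_sum_sq_eq_one _
  have hneg {v} (hv : v ∈ S) : -v ∈ S := by simpa [S] using hv
  have hne : S.Nonempty := ⟨Pi.single 0 1, by
    simp [S, Pi.single_apply]⟩
  obtain ⟨v₀, hv₀, hmin⟩ := hS.exists_isMinOn hne hc.norm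
  refine ⟨v₀, hv₀, ?_⟩
  by_contra h0
  have hpos : 0 < ‖h v₀‖ := norm_pos_iff.2 h0
  set ε := ‖h v₀‖ / 4
  have hε : 0 < ε := by positivity
  have happ (i : Fin N) := MvPolynomial.exists_near_on_isCompact hS
    (f := fun v => h v i) (continuousOn_pi.1 hc i) hε
  choose P hP using happ
  obtain ⟨v, hv, hsmall⟩ := MvPolynomial.exists_approx_zero_on_sphere
    (fun i => P i - MvPolynomial.negVars _ (P i)) (t := ε)
    (fun i => by
      have : MvPolynomial.negVars (Fin (N + 1)) (MvPolynomial.negVars _ (P i)) = P i := by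
        refine MvPolynomial.funext fun x => ?_
        simp [MvPolynomial.eval_negVars]
      rw [map_sub, this, neg_sub]) hε
  have hle : ‖h v‖ ≤ 2 * ε := by
    rw [pi_norm_le_iff_of_nonneg (by positivity)]
    intro i
    have h1 := hP i v hv
    have h2 := hP i (-v) (hneg hv)
    have h3 := hsmall i
    rw [hodd v hv, Pi.neg_apply] at h2
    rw [map_sub, MvPolynomial.eval_negVars] at h3
    rw [abs_lt] at h1 h2
    rw [abs_le] at h3
    rw [Real.norm_eq_abs, abs_le]
    constructor <;> linarith
  have := hmin hv
  simp only [Set.mem_ofPred_eq] at this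
  have h4 : ‖h v₀‖ = 4 * ε := by simp only [ε]; ring
  linarith

/-- The support of a finitely indexed real vector, as a `Finset`. -/
noncomputable def vecSupport {ι : Type} [Fintype ι] (x : ι → ℝ) : Finset ι :=
  Finset.univ.filter fun i => x i ≠ 0

@[simp]
theorem mem_vecSupport {ι : Type} [Fintype ι] {x : ι → ℝ} {i : ι} :
    i ∈ vecSupport x ↔ x i ≠ 0 := by
  simp [vecSupport]

/-- The union of the faces with at most `j` vertices of the standard simplex. -/
def simplexSkeleton (ι : Type) [Fintype ι] (j : ℕ) : Set (ι → ℝ) :=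
  {x ∈ stdSimplex ℝ ι | (vecSupport x).card ≤ j}

/-- The face of the standard simplex spanned by `s`. -/
def simplexFace {ι : Type} [Fintype ι] (s : Finset ι) : Set (ι → ℝ) :=
  {x ∈ stdSimplex ℝ ι | vecSupport x ⊆ s}

theorem isClosed_simplexFace {ι : Type} [Fintype ι] (s : Finset ι) :
    IsClosed (simplexFace s) := by
  have : simplexFace s = stdSimplex ℝ ι ∩ ⋂ i ∈ (s : Set ι)ᶜ, {x | x i = 0} := by
    ext x
    simp only [simplexFace, Set.mem_ofPred_eq, Set.mem_inter_iff, Set.mem_iInter, Finset.subset_iff,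
      mem_vecSupport, Set.mem_compl_iff, Finset.mem_coe, ne_eq]
    refine and_congr_right fun _ => forall_congr' fun i => not_imp_comm
  rw [this]
  exact (isClosed_stdSimplex ℝ ι).inter
    (isClosed_biInter fun i _ => isClosed_eq (continuous_apply i) continuous_const)

theorem simplexSkeleton_eq_biUnion {ι : Type} [Fintype ι] (j : ℕ) :
    simplexSkeleton ι j = ⋃ s ∈ {s : Finset ι | s.card ≤ j}, simplexFace s := by
  ext x
  simp only [simplexSkeleton, simplexFace, Set.mem_iUnion, Set.mem_ofPred_eq, exists_prop]
  exact ⟨fun h => ⟨_, h.2, h.1, subset_rfl⟩,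
    fun ⟨s, hs, h1, h2⟩ => ⟨h1, (Finset.card_le_card h2).trans hs⟩⟩

theorem isClosed_simplexSkeleton (ι : Type) [Fintype ι] (j : ℕ) :
    IsClosed (simplexSkeleton ι j) := by
  rw [simplexSkeleton_eq_biUnion]
  exact (Set.toFinite _).isClosed_biUnion fun s _ => isClosed_simplexFace s

theorem single_mem_simplexSkeleton {ι : Type} [Fintype ι] [DecidableEq ι] (i : ι) {j : ℕ}
    (hj : 1 ≤ j) : Pi.single i 1 ∈ simplexSkeleton ι j := by
  refine ⟨single_mem_stdSimplex ℝ i, le_trans (Finset.card_le_one.2 ?_) hj⟩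
  intro a ha b hb
  simp only [mem_vecSupport, Pi.single_apply, ne_eq, ite_eq_right_iff, one_ne_zero, imp_false,
    not_not] at ha hb
  rw [ha, hb]

/-- The positive part of a vector, rescaled to have coordinate sum one. -/
noncomputable def normalizedPosPart {ι : Type} [Fintype ι] (x : ι → ℝ) : ι → ℝ :=
  (∑ i, max (x i) 0)⁻¹ • fun i => max (x i) 0

theorem sum_posPart_pos {ι : Type} [Fintype ι] {x : ι → ℝ} (h0 : x ≠ 0) (hx : ∑ i, x i = 0) :
    0 < ∑ i, max (x i) 0 := by
  refine (Finset.sum_nonneg fun i _ => le_max_right _ _).lt_of_ne' fun h => h0 ?_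
  have h1 : ∀ i, x i ≤ 0 := fun i => by
    have := (Finset.sum_eq_zero_iff_of_nonneg fun i _ => le_max_right (x i) 0).1 h i
      (Finset.mem_univ i)
    exact max_eq_right_iff.1 this
  ext i
  exact (Finset.sum_eq_zero_iff_of_nonpos fun i _ => h1 i).1 hx i (Finset.mem_univ i)

theorem normalizedPosPart_mem_stdSimplex {ι : Type} [Fintype ι] {x : ι → ℝ} (h0 : x ≠ 0)
    (hx : ∑ i, x i = 0) : normalizedPosPart x ∈ stdSimplex ℝ ι := by
  have h := sum_posPart_pos h0 hx
  refine ⟨fun i => mul_nonneg (inv_nonneg.2 h.le) (le_max_right _ _), ?_⟩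
  simp only [normalizedPosPart, Pi.smul_apply, smul_eq_mul]
  rw [← Finset.mul_sum, inv_mul_cancel₀ h.ne']

theorem disjoint_vecSupport_normalizedPosPart_neg {ι : Type} [Fintype ι] (x : ι → ℝ) :
    Disjoint (vecSupport (normalizedPosPart x)) (vecSupport (normalizedPosPart (-x))) := by
  refine Finset.disjoint_left.2 fun i h1 h2 => ?_
  rw [mem_vecSupport] at h1 h2
  simp only [normalizedPosPart, Pi.smul_apply, smul_eq_mul, ne_eq, mul_eq_zero, not_or,
    max_eq_right_iff, not_le, Pi.neg_apply] at h1 h2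
  linarith [h1.2, h2.2]

/-- The **van Kampen–Flores theorem**: a continuous map from the `k`-skeleton of a simplex with
`2 * k + 3` vertices to `ℝ^d` with `d ≤ 2 * k` identifies two points with disjoint supports. -/
theorem van_kampen_flores {k d : ℕ} (hd : d ≤ 2 * k) {f : (Fin (2 * k + 3) → ℝ) → Fin d → ℝ}
    (hf : ContinuousOn f (simplexSkeleton (Fin (2 * k + 3)) (k + 1))) :
    ∃ x ∈ simplexSkeleton (Fin (2 * k + 3)) (k + 1),
      ∃ y ∈ simplexSkeleton (Fin (2 * k + 3)) (k + 1),
        Disjoint (vecSupport x) (vecSupport y) ∧ f x = f y := by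
  set K := simplexSkeleton (Fin (2 * k + 3)) (k + 1)
  have hK : IsClosed K := isClosed_simplexSkeleton _ _
  have hKne : K.Nonempty := ⟨_, single_mem_simplexSkeleton 0 (by omega)⟩
  obtain ⟨F, hF⟩ := ContinuousMap.exists_restrict_eq hK ⟨K.domRestrict f, hf.domRestrict⟩
  have hFf : ∀ x ∈ K, F x = f x := fun x hx => DFunLike.congr_fun hF ⟨x, hx⟩
  let L : (Fin (2 * k + 2) → ℝ) → Fin (2 * k + 3) → ℝ := fun y => Fin.cons (-∑ i, y i) y
  have hLneg (y) : L (-y) = -L y := by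
    ext i
    refine Fin.cases ?_ (fun i => ?_) i <;> simp [L]
  have hLsum (y) : ∑ i, L y i = 0 := by simp [L, Fin.sum_univ_succ (n := 2 * k + 2)]
  have hL0 {y} (hy : ∑ i, y i ^ 2 = 1) : L y ≠ 0 := fun h => by
    have : y = 0 := funext fun i => by simpa [L] using congr_fun h i.succ
    simp [this] at hy
  have hLc : Continuous L := by
    refine continuous_pi fun i => ?_
    refine Fin.cases ?_ (fun i => ?_) i
    · simp only [L, Fin.cons_zero]; fun_prop
    · simp only [L, Fin.cons_succ]; fun_prop
  let g : (Fin (2 * k + 3) → ℝ) → Fin (2 * k + 1) → ℝ := fun x =>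
    Fin.cons (Metric.infDist x K) fun i : Fin (2 * k) => if h : i < d then F x ⟨i, h⟩ else 0
  have hgc : Continuous g := by
    refine continuous_pi fun i => ?_
    refine Fin.cases ?_ (fun i => ?_) i
    · simp only [g, Fin.cons_zero]; exact Metric.continuous_infDist_pt K
    · simp only [g, Fin.cons_succ]
      split_ifs with h
      · exact (continuous_apply _).comp F.continuous
      · exact continuous_const
  let P := fun y => normalizedPosPart (L y)
  have hm : Continuous fun y i => max (L y i) 0 :=
    continuous_pi fun i => ((continuous_apply i).comp hLc).max continuous_const
  have hs : Continuous fun y => ∑ i, max (L y i) 0 :=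
    continuous_finsetSum _ fun i _ => (continuous_pi_iff.1 hm) i
  have hPc : ContinuousOn P {y | ∑ i, y i ^ 2 = 1} := by
    simp only [P, normalizedPosPart]
    exact (hs.continuousOn.inv₀ fun y hy =>
      (sum_posPart_pos (hL0 hy) (hLsum y)).ne').smul hm.continuousOn
  obtain ⟨v, hv, hzero⟩ := borsuk_ulam (h := fun y => g (P y) - g (P (-y)))
    ((hgc.comp_continuousOn hPc).sub (hgc.comp_continuousOn
      (hPc.comp continuous_neg.continuousOn fun y hy => by simpa using hy)))
    (fun y _ => by simp)
  have hv' : ∑ i, (-v) i ^ 2 = 1 := by simpa using hv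
  have hg : g (P v) = g (P (-v)) := sub_eq_zero.1 hzero
  have hdist : Metric.infDist (P v) K = Metric.infDist (P (-v)) K := by
    simpa [g] using congr_fun hg 0
  have hFF : F (P v) = F (P (-v)) := by
    ext i
    have h := congr_fun hg (Fin.succ ⟨i, i.2.trans_le hd⟩)
    simp only [g, Fin.cons_succ] at h
    simpa using h
  have hS1 : P v ∈ stdSimplex ℝ (Fin (2 * k + 3)) :=
    normalizedPosPart_mem_stdSimplex (hL0 hv) (hLsum v)
  have hS2 : P (-v) ∈ stdSimplex ℝ (Fin (2 * k + 3)) :=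
    normalizedPosPart_mem_stdSimplex (hL0 hv') (hLsum _)
  have hdisj : Disjoint (vecSupport (P v)) (vecSupport (P (-v))) := by
    simp only [P, hLneg]
    exact disjoint_vecSupport_normalizedPosPart_neg _
  have hcard : (vecSupport (P v)).card + (vecSupport (P (-v))).card ≤ 2 * k + 3 := by
    rw [← Finset.card_union_of_disjoint hdisj]
    simpa using Finset.card_le_univ (vecSupport (P v) ∪ vecSupport (P (-v)))
  have hmem : P v ∈ K ∧ P (-v) ∈ K := by
    rw [hK.mem_iff_infDist_zero hKne, hK.mem_iff_infDist_zero hKne, ← hdist, and_self]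
    rcases le_or_gt (vecSupport (P v)).card (k + 1) with h | h
    · exact Metric.infDist_zero_of_mem ⟨hS1, h⟩
    · rw [hdist]
      exact Metric.infDist_zero_of_mem ⟨hS2, by omega⟩
  exact ⟨_, hmem.1, _, hmem.2, hdisj, by rw [← hFf _ hmem.1, ← hFf _ hmem.2, hFF]⟩

section Extension

open scoped unitInterval Topology

section Diamond

variable {n : ℕ}

/-- The norm on `ℝ^(n+1)` adding the absolute value of the first coordinate to the supremum norm
of the other ones. -/
noncomputable def diamondNorm (z : Fin (n + 1) → ℝ) : ℝ := ‖fun i : Fin n => z i.succ‖ + |z 0|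

theorem continuous_diamondNorm : Continuous (diamondNorm (n := n)) := by
  unfold diamondNorm
  fun_prop

theorem diamondNorm_nonneg (z : Fin (n + 1) → ℝ) : 0 ≤ diamondNorm z := by
  unfold diamondNorm
  positivity

theorem diamondNorm_smul (a : ℝ) (z : Fin (n + 1) → ℝ) :
    diamondNorm (a • z) = |a| * diamondNorm z := by
  have : (fun i : Fin n => (a • z) i.succ) = a • fun i : Fin n => z i.succ := rfl
  rw [diamondNorm, diamondNorm, this, norm_smul, Pi.smul_apply, smul_eq_mul, abs_mul, mul_add,
    Real.norm_eq_abs]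

theorem diamondNorm_add_le (x y : Fin (n + 1) → ℝ) :
    diamondNorm (x + y) ≤ diamondNorm x + diamondNorm y := by
  have h1 := norm_add_le (fun i : Fin n => x i.succ) (fun i : Fin n => y i.succ)
  have h2 := abs_add_le (x 0) (y 0)
  exact (add_le_add h1 h2).trans_eq (add_add_add_comm _ _ _ _)

theorem norm_le_diamondNorm (z : Fin (n + 1) → ℝ) : ‖z‖ ≤ diamondNorm z := by
  rw [pi_norm_le_iff_of_nonneg (diamondNorm_nonneg z)]
  refine Fin.cases ?_ fun i => ?_
  · exact le_add_of_nonneg_left (norm_nonneg _)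
  · exact (norm_le_pi_norm (fun i : Fin n => z i.succ) i).trans
      (le_add_of_nonneg_right (abs_nonneg _))

theorem diamondNorm_zero : diamondNorm (0 : Fin (n + 1) → ℝ) = 0 := by
  simpa using diamondNorm_smul 0 (0 : Fin (n + 1) → ℝ)

/-- The radial scaling factor used in `diamondWrap`. -/
noncomputable def diamondScale (r : ℝ) : ℝ := min 2 (2 * (1 - r) / max r (1 / 2))

theorem continuous_diamondScale : Continuous diamondScale := by
  refine continuous_const.min (Continuous.div (by fun_prop) (by fun_prop) fun r => ?_)
  have := le_max_right r (1 / 2)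
  linarith

theorem diamondScale_of_le {r : ℝ} (h1 : r ≤ 1 / 2) : diamondScale r = 2 := by
  rw [diamondScale, max_eq_right h1, min_eq_left]
  rw [le_div_iff₀ (by norm_num)]
  linarith

theorem diamondScale_of_ge {r : ℝ} (h1 : 1 / 2 ≤ r) : diamondScale r = 2 * (1 - r) / r := by
  rw [diamondScale, max_eq_left h1, min_eq_right]
  rw [div_le_iff₀ (by linarith)]
  linarith

theorem diamondScale_mul_self (r : ℝ) : diamondScale r * r = 1 - |1 - 2 * r| := by
  rcases le_total r (1 / 2) with h | h
  · rw [diamondScale_of_le h, abs_of_nonneg (by linarith)]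
    ring
  · rw [diamondScale_of_ge h, abs_of_nonpos (by linarith), div_mul_cancel₀ _ (by linarith)]
    ring

theorem diamondScale_pos {r : ℝ} (hr : r < 1) : 0 < diamondScale r := by
  rcases le_total r (1 / 2) with h | h
  · rw [diamondScale_of_le h]
    norm_num
  · rw [diamondScale_of_ge h]
    exact div_pos (by linarith) (by linarith)

theorem diamondScale_nonneg {r : ℝ} (hr : r ≤ 1) : 0 ≤ diamondScale r := by
  rcases hr.lt_or_eq with h | rfl
  · exact (diamondScale_pos h).le
  · rw [diamondScale_of_ge (by norm_num)]
    norm_num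

/-- The map wrapping the unit ball of `ℝ^n` around the unit sphere of `diamondNorm`, collapsing
the boundary to a point. -/
noncomputable def diamondWrap (u : Fin n → ℝ) : Fin (n + 1) → ℝ :=
  Fin.cons (1 - 2 * ‖u‖) (diamondScale ‖u‖ • u)

theorem continuous_diamondWrap : Continuous (diamondWrap (n := n)) := by
  refine continuous_pi (Fin.cases ?_ fun i => ?_)
  · simp only [diamondWrap, Fin.cons_zero]
    fun_prop
  · simp only [diamondWrap, Fin.cons_succ, Pi.smul_apply, smul_eq_mul]
    exact (continuous_diamondScale.comp continuous_norm).mul (continuous_apply i)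

theorem diamondNorm_diamondWrap {u : Fin n → ℝ} (hu : ‖u‖ ≤ 1) :
    diamondNorm (diamondWrap u) = 1 := by
  have : (fun i : Fin n => diamondWrap u i.succ) = diamondScale ‖u‖ • u := by
    ext i
    simp [diamondWrap]
  rw [diamondNorm, this, norm_smul, Real.norm_of_nonneg (diamondScale_nonneg hu),
    diamondScale_mul_self]
  simp [diamondWrap]

theorem exists_diamondWrap_eq (hn : 1 ≤ n) {z : Fin (n + 1) → ℝ} (hz : diamondNorm z = 1) :
    ∃ u : Fin n → ℝ, ‖u‖ ≤ 1 ∧ diamondWrap u = z := by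
  set w : Fin n → ℝ := fun i => z i.succ with hw
  have hz' : ‖w‖ = 1 - |z 0| := by rw [← hz, diamondNorm]; ring
  have h0 : |z 0| ≤ 1 := by linarith [norm_nonneg w]
  rw [abs_le] at h0
  set r := (1 - z 0) / 2 with hr
  have hr1 : 1 - 2 * r = z 0 := by rw [hr]; ring
  suffices ∃ u : Fin n → ℝ, ‖u‖ = r ∧ diamondScale r • u = w by
    obtain ⟨u, hu, huw⟩ := this
    refine ⟨u, by rw [hu]; linarith, ?_⟩
    ext i
    refine Fin.cases ?_ (fun i => ?_) i
    · simp [diamondWrap, hu, hr1]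
    · simpa [diamondWrap, hu, hw] using congr_fun huw i
  rcases h0.1.lt_or_eq with h | h
  · have hc : 0 < diamondScale r := diamondScale_pos (by linarith)
    refine ⟨(diamondScale r)⁻¹ • w, ?_, smul_inv_smul₀ hc.ne' w⟩
    rw [norm_smul, norm_inv, Real.norm_of_nonneg hc.le, hz', inv_mul_eq_iff_eq_mul₀ hc.ne',
      diamondScale_mul_self, hr1]
  · have hr2 : r = 1 := by linarith
    have : Nonempty (Fin n) := ⟨⟨0, hn⟩⟩
    refine ⟨fun _ => 1, by simp [hr2], ?_⟩
    have : w = 0 := by rw [← norm_eq_zero, hz', ← h]; norm_num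
    rw [this, hr2, diamondScale_of_ge (by norm_num)]
    simp

theorem eq_or_norm_eq_one_of_diamondWrap_eq {u v : Fin n → ℝ} (hu : ‖u‖ ≤ 1)
    (h : diamondWrap u = diamondWrap v) : u = v ∨ ‖u‖ = 1 ∧ ‖v‖ = 1 := by
  have h0 : ‖u‖ = ‖v‖ := by
    have := congr_fun h 0
    simp only [diamondWrap, Fin.cons_zero] at this
    linarith
  have h1 : diamondScale ‖u‖ • u = diamondScale ‖u‖ • v := by
    ext i
    simpa [diamondWrap, ← h0] using congr_fun h i.succ
  rcases hu.lt_or_eq with hlt | heq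
  · exact Or.inl (smul_right_injective _ (diamondScale_pos hlt).ne' h1)
  · exact Or.inr ⟨heq, h0 ▸ heq⟩

theorem diamondWrap_of_norm_eq_one {u : Fin n → ℝ} (hu : ‖u‖ = 1) :
    diamondWrap u = Fin.cons (-1) 0 := by
  rw [diamondWrap, hu, diamondScale_of_ge (by norm_num)]
  norm_num

/-- The homeomorphism from the unit cube onto `[-1, 1]^n`. -/
def centeredCube (x : I^Fin n) : Fin n → ℝ := fun i => 2 * (x i : ℝ) - 1

theorem continuous_centeredCube : Continuous (centeredCube (n := n)) := by
  unfold centeredCube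
  fun_prop

theorem norm_centeredCube_le (x : I^Fin n) : ‖centeredCube x‖ ≤ 1 := by
  rw [pi_norm_le_iff_of_nonneg zero_le_one]
  intro i
  rw [Real.norm_eq_abs, abs_le, centeredCube]
  constructor <;> linarith [(x i).2.1, (x i).2.2]

theorem centeredCube_injective : Function.Injective (centeredCube (n := n)) := by
  intro x y h
  ext i
  have := congr_fun h i
  simp only [centeredCube] at this
  linarith

theorem exists_centeredCube_eq {u : Fin n → ℝ} (hu : ‖u‖ ≤ 1) : ∃ x, centeredCube x = u := by
  have h (i) := abs_le.1 ((norm_le_pi_norm u i).trans hu)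
  refine ⟨fun i => ⟨(u i + 1) / 2, ?_, ?_⟩, ?_⟩
  · linarith [(h i).1]
  · linarith [(h i).2]
  · ext i
    simp only [centeredCube]
    ring

theorem mem_cubeBoundary_iff_norm (hn : 1 ≤ n) (x : I^Fin n) :
    x ∈ Cube.boundary (Fin n) ↔ ‖centeredCube x‖ = 1 := by
  constructor
  · rintro ⟨i, hi⟩
    refine le_antisymm (norm_centeredCube_le x) ?_
    refine le_trans (le_of_eq ?_) (norm_le_pi_norm (centeredCube x) i)
    rcases hi with hi | hi <;> norm_num [centeredCube, hi]
  · intro h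
    have : Nonempty (Fin n) := ⟨⟨0, hn⟩⟩
    obtain ⟨i, hi⟩ := Finite.exists_max fun i => ‖centeredCube x i‖
    refine ⟨i, ?_⟩
    have h1 : 1 ≤ ‖centeredCube x i‖ := by
      rw [← h, pi_norm_le_iff_of_nonneg (norm_nonneg _)]
      exact hi
    rw [Real.norm_eq_abs, le_abs', centeredCube] at h1
    rcases h1 with h1 | h1
    · left; ext; simp only [Set.Icc.coe_zero]; linarith [(x i).2.1]
    · right; ext; simp only [Set.Icc.coe_one]; linarith [(x i).2.2]

/-- A map from the unit sphere of `diamondNorm` to a space with trivial `n`-th homotopy groups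
extends to the unit ball. -/
theorem exists_extension_diamondBall (hn : 1 ≤ n) {X : Type} [TopologicalSpace X]
    (hX : ∀ x : X, Subsingleton (HomotopyGroup (Fin n) X x)) {φ : (Fin (n + 1) → ℝ) → X}
    (hφ : ContinuousOn φ {z | diamondNorm z = 1}) :
    ∃ Φ : (Fin (n + 1) → ℝ) → X, ContinuousOn Φ {z | diamondNorm z ≤ 1} ∧
      Set.EqOn Φ φ {z | diamondNorm z = 1} := by
  set x₀ : X := φ (Fin.cons (-1) 0)
  let q : (I^Fin n) → Fin (n + 1) → ℝ := fun x => diamondWrap (centeredCube x)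
  have hqc : Continuous q := continuous_diamondWrap.comp continuous_centeredCube
  have hq1 (x) : diamondNorm (q x) = 1 := diamondNorm_diamondWrap (norm_centeredCube_le x)
  let γ : GenLoop (Fin n) X x₀ := ⟨⟨fun x => φ (q x), hφ.comp_continuous hqc hq1⟩, fun x hx => by
    simp only [ContinuousMap.coe_mk, q,
      diamondWrap_of_norm_eq_one ((mem_cubeBoundary_iff_norm hn x).1 hx), x₀]⟩
  have hsub : (Quotient.mk _ γ : HomotopyGroup (Fin n) X x₀) = Quotient.mk _ GenLoop.const :=
    (hX x₀).elim _ _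
  obtain ⟨H⟩ : GenLoop.Homotopic γ GenLoop.const := Quotient.exact hsub
  let Ball := {z : Fin (n + 1) → ℝ | diamondNorm z ≤ 1}
  have hQnorm (p : I × I^Fin n) : diamondNorm ((1 - (p.1 : ℝ)) • q p.2) = 1 - p.1 := by
    rw [diamondNorm_smul, hq1, mul_one, abs_of_nonneg (by linarith [p.1.2.2])]
  let Q : I × (I^Fin n) → Ball := fun p => ⟨(1 - (p.1 : ℝ)) • q p.2, by
    have := hQnorm p
    simp only [Ball, Set.mem_ofPred_eq]
    linarith [p.1.2.1]⟩
  have hQc : Continuous Q := by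
    refine Continuous.subtype_mk ?_ _
    fun_prop
  have hqsurj {z} (hz : diamondNorm z = 1) : ∃ x, q x = z := by
    obtain ⟨u, hu, rfl⟩ := exists_diamondWrap_eq hn hz
    obtain ⟨x, rfl⟩ := exists_centeredCube_eq hu
    exact ⟨x, rfl⟩
  have hQsurj : Function.Surjective Q := by
    rintro ⟨z, hz⟩
    have hz : diamondNorm z ≤ 1 := hz
    rcases (diamondNorm_nonneg z).eq_or_lt with h0 | h0
    · refine ⟨(1, 0), Subtype.ext ?_⟩
      have : z = 0 := norm_eq_zero.1 (le_antisymm (h0 ▸ norm_le_diamondNorm z) (norm_nonneg _))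
      simp [Q, this]
    · obtain ⟨x, hx⟩ := hqsurj (z := (diamondNorm z)⁻¹ • z) (by
        rw [diamondNorm_smul, abs_of_pos (inv_pos.2 h0), inv_mul_cancel₀ h0.ne'])
      refine ⟨(⟨1 - diamondNorm z, by linarith, by linarith⟩, x), Subtype.ext ?_⟩
      simp only [Q, hx, sub_sub_cancel]
      exact smul_inv_smul₀ h0.ne' z
  have hquot : Topology.IsQuotientMap (⟨Q, hQc⟩ : C(_, Ball)) :=
    hQc.isClosedMap.isQuotientMap hQc hQsurj
  have hfib : Function.FactorsThrough H (⟨Q, hQc⟩ : C(_, Ball)) := by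
    rintro ⟨s, x⟩ ⟨s', x'⟩ h
    have h' : (1 - (s : ℝ)) • q x = (1 - (s' : ℝ)) • q x' := congr_arg Subtype.val h
    have hs : s = s' := by
      have h1 := hQnorm (s, x)
      have h2 := hQnorm (s', x')
      simp only at h1 h2
      rw [h', h2] at h1
      ext
      linarith
    subst hs
    by_cases hs1 : s = 1
    · subst hs1
      simp
    · have hne : (1 - (s : ℝ)) ≠ 0 := fun h => hs1 (Subtype.ext (sub_eq_zero.1 h).symm)
      have hqq : q x = q x' := smul_right_injective _ hne h'
      rcases eq_or_norm_eq_one_of_diamondWrap_eq (norm_centeredCube_le x) hqq with h | ⟨h1, h2⟩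
      · rw [centeredCube_injective h]
      · have e1 := H.eq_fst s ((mem_cubeBoundary_iff_norm hn x).2 h1)
        have e2 := H.eq_fst s ((mem_cubeBoundary_iff_norm hn x').2 h2)
        rw [e1, e2]
        exact congr_arg φ hqq
  let Ψ : C(Ball, X) := hquot.lift H.toContinuousMap hfib
  have hΨ (p) : Ψ (Q p) = H p :=
    DFunLike.congr_fun (hquot.lift_comp H.toContinuousMap hfib) p
  classical
  refine ⟨fun z => if hz : z ∈ Ball then Ψ ⟨z, hz⟩ else x₀, ?_, fun z hz => ?_⟩
  · rw [continuousOn_iff_continuous_domRestrict]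
    convert! Ψ.continuous using 1
    ext ⟨z, hz⟩
    simp only [Set.domRestrict_apply]
    exact dif_pos hz
  · have hz : diamondNorm z = 1 := hz
    have hzB : z ∈ Ball := hz.le
    simp only [dif_pos hzB]
    obtain ⟨x, rfl⟩ := hqsurj hz
    have : (⟨q x, hzB⟩ : Ball) = Q (0, x) := Subtype.ext (by simp [Q])
    rw [this, hΨ]
    simp [γ]

end Diamond

theorem exists_pos_add_smul_mem_of_mem_interior {E : Type} [NormedAddCommGroup E]
    [NormedSpace ℝ E] {C : Set E} {z : E} (hz : z ∈ interior C) (v : E) :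
    ∃ ε : ℝ, 0 < ε ∧ z + ε • v ∈ C := by
  have hc : Filter.Tendsto (fun ε : ℝ => z + ε • v) (𝓝[>] 0) (𝓝 z) := by
    have : Continuous fun ε : ℝ => z + ε • v := by fun_prop
    simpa using (this.tendsto 0).mono_left nhdsWithin_le_nhds
  obtain ⟨ε, h1, h2⟩ := ((hc.eventually (mem_interior_iff_mem_nhds.1 hz)).and
    self_mem_nhdsWithin).exists
  exact ⟨ε, h2, h1⟩

section

variable {n : ℕ}

theorem convex_diamondBall : Convex ℝ {z : Fin (n + 1) → ℝ | diamondNorm z ≤ 1} := by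
  intro x hx y hy a b ha hb hab
  have h := diamondNorm_add_le (a • x) (b • y)
  rw [diamondNorm_smul, diamondNorm_smul, abs_of_nonneg ha, abs_of_nonneg hb] at h
  have hx : diamondNorm x ≤ 1 := hx
  have hy : diamondNorm y ≤ 1 := hy
  change diamondNorm _ ≤ 1
  nlinarith

theorem isClosed_diamondBall : IsClosed {z : Fin (n + 1) → ℝ | diamondNorm z ≤ 1} :=
  isClosed_le continuous_diamondNorm continuous_const

theorem subset_interior_diamondBall :
    {z : Fin (n + 1) → ℝ | diamondNorm z < 1} ⊆ interior {z | diamondNorm z ≤ 1} :=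
  interior_maximal (fun z (hz : diamondNorm z < 1) => show diamondNorm z ≤ 1 from hz.le)
    (isOpen_lt continuous_diamondNorm continuous_const)

theorem frontier_diamondBall :
    frontier {z : Fin (n + 1) → ℝ | diamondNorm z ≤ 1} = {z | diamondNorm z = 1} := by
  refine Set.Subset.antisymm (frontier_le_subset_eq continuous_diamondNorm continuous_const)
    fun z hz => ?_
  have hz : diamondNorm z = 1 := hz
  rw [isClosed_diamondBall.frontier_eq]
  refine ⟨hz.le, fun h => ?_⟩
  obtain ⟨ε, h1, h2⟩ := exists_pos_add_smul_mem_of_mem_interior h z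
  have h3 : z + ε • z = (1 + ε) • z := by module
  rw [Set.mem_ofPred_eq, h3, diamondNorm_smul, hz, abs_of_pos (by linarith)] at h2
  linarith

/-- The simplex in `ℝ^(n+1)` spanned by the origin and the standard basis. -/
def cornerSimplex (n : ℕ) : Set (Fin (n + 1) → ℝ) := {z | (∀ i, 0 ≤ z i) ∧ ∑ i, z i ≤ 1}

theorem isClosed_cornerSimplex : IsClosed (cornerSimplex n) := by
  have hsum : Continuous fun z : Fin (n + 1) → ℝ => ∑ i, z i := by fun_prop
  refine IsClosed.inter ?_ (isClosed_le hsum continuous_const)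
  have : {z : Fin (n + 1) → ℝ | ∀ i, 0 ≤ z i} = ⋂ i, {z | 0 ≤ z i} := by ext; simp
  change IsClosed {z : Fin (n + 1) → ℝ | ∀ i, 0 ≤ z i}
  rw [this]
  exact isClosed_iInter fun i => isClosed_le continuous_const (continuous_apply i)

theorem convex_cornerSimplex : Convex ℝ (cornerSimplex n) := by
  intro x hx y hy a b ha hb hab
  refine ⟨fun i => add_nonneg (mul_nonneg ha (hx.1 i)) (mul_nonneg hb (hy.1 i)), ?_⟩
  simp only [Pi.add_apply, Pi.smul_apply, smul_eq_mul, Finset.sum_add_distrib, ← Finset.mul_sum]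
  nlinarith [hx.2, hy.2]

theorem isBounded_cornerSimplex : Bornology.IsBounded (cornerSimplex n) := by
  refine (Metric.isBounded_closedBall (x := (0 : Fin (n + 1) → ℝ)) (r := 1)).subset fun z hz => ?_
  rw [mem_closedBall_zero_iff, pi_norm_le_iff_of_nonneg zero_le_one]
  intro i
  rw [Real.norm_of_nonneg (hz.1 i)]
  exact (Finset.single_le_sum (fun i _ => hz.1 i) (Finset.mem_univ i)).trans hz.2

theorem isBounded_diamondBall :
    Bornology.IsBounded {z : Fin (n + 1) → ℝ | diamondNorm z ≤ 1} := by
  refine (Metric.isBounded_closedBall (x := (0 : Fin (n + 1) → ℝ)) (r := 1)).subset fun z hz => ?_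
  rw [mem_closedBall_zero_iff]
  exact (norm_le_diamondNorm z).trans hz

theorem subset_interior_cornerSimplex :
    {z : Fin (n + 1) → ℝ | (∀ i, 0 < z i) ∧ ∑ i, z i < 1} ⊆ interior (cornerSimplex n) := by
  refine interior_maximal (fun z hz => ⟨fun i => (hz.1 i).le, hz.2.le⟩) ?_
  have hsum : Continuous fun z : Fin (n + 1) → ℝ => ∑ i, z i := by fun_prop
  refine IsOpen.inter ?_ (isOpen_lt hsum continuous_const)
  have : {z : Fin (n + 1) → ℝ | ∀ i, 0 < z i} = ⋂ i, {z | 0 < z i} := by ext; simp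
  change IsOpen {z : Fin (n + 1) → ℝ | ∀ i, 0 < z i}
  rw [this]
  exact isOpen_iInter_of_finite fun i => isOpen_lt continuous_const (continuous_apply i)

theorem nonempty_interior_cornerSimplex : (interior (cornerSimplex n)).Nonempty := by
  refine ⟨fun _ => 1 / (n + 2), subset_interior_cornerSimplex ⟨fun _ => by positivity, ?_⟩⟩
  simp only [Finset.sum_const, Finset.card_univ, Fintype.card_fin, nsmul_eq_mul]
  rw [mul_one_div, div_lt_one (by positivity)]
  push_cast
  linarith

theorem frontier_cornerSimplex :
    frontier (cornerSimplex n) =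
      {z ∈ cornerSimplex n | (∃ i, z i = 0) ∨ ∑ i, z i = 1} := by
  rw [isClosed_cornerSimplex.frontier_eq]
  ext z
  refine and_congr_right fun hz => ?_
  constructor
  · intro h
    contrapose! h
    exact subset_interior_cornerSimplex
      ⟨fun i => (hz.1 i).lt_of_ne' (h.1 i), hz.2.lt_of_ne h.2⟩
  · rintro (⟨i, hi⟩ | h1) h
    · obtain ⟨ε, h1, h2⟩ := exists_pos_add_smul_mem_of_mem_interior h (fun _ => -1)
      have := h2.1 i
      simp only [Pi.add_apply, hi, Pi.smul_apply, smul_eq_mul] at this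
      linarith
    · obtain ⟨ε, h2, h3⟩ := exists_pos_add_smul_mem_of_mem_interior h (Pi.single 0 1)
      have := h3.2
      simp only [Pi.add_apply, Finset.sum_add_distrib, h1, Pi.smul_apply, smul_eq_mul,
        ← Finset.mul_sum, Finset.sum_pi_single'] at this
      simp at this
      linarith

theorem exists_extension_cornerSimplex (hn : 1 ≤ n) {X : Type} [TopologicalSpace X]
    (hX : ∀ x : X, Subsingleton (HomotopyGroup (Fin n) X x)) {φ : (Fin (n + 1) → ℝ) → X}
    (hφ : ContinuousOn φ {z ∈ cornerSimplex n | (∃ i, z i = 0) ∨ ∑ i, z i = 1}) :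
    ∃ Φ : (Fin (n + 1) → ℝ) → X, ContinuousOn Φ (cornerSimplex n) ∧
      Set.EqOn Φ φ {z ∈ cornerSimplex n | (∃ i, z i = 0) ∨ ∑ i, z i = 1} := by
  obtain ⟨e, -, he, he'⟩ := exists_homeomorph_image_eq (convex_diamondBall (n := n))
    ⟨0, subset_interior_diamondBall (by simp [diamondNorm_zero])⟩
    (NormedSpace.isVonNBounded_of_isBounded ℝ isBounded_diamondBall) convex_cornerSimplex
    nonempty_interior_cornerSimplex
    (NormedSpace.isVonNBounded_of_isBounded ℝ isBounded_cornerSimplex)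
  rw [isClosed_diamondBall.closure_eq, isClosed_cornerSimplex.closure_eq] at he
  rw [frontier_diamondBall, frontier_cornerSimplex] at he'
  rw [← he'] at hφ
  obtain ⟨Φ, h1, h2⟩ := exists_extension_diamondBall hn hX (φ := φ ∘ e)
    (hφ.comp e.continuous.continuousOn (Set.mapsTo_image _ _))
  rw [← he', ← he]
  refine ⟨Φ ∘ e.symm, h1.comp e.symm.continuous.continuousOn ?_, ?_⟩
  · rintro _ ⟨z, hz, rfl⟩
    simpa using hz
  · rintro _ ⟨z, hz, rfl⟩
    simpa using h2 hz

/-- A map from the boundary of a simplex of dimension `n + 1` to a space with trivial `n`-th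
homotopy groups extends to the simplex. -/
theorem exists_extension_simplexFace (hn : 1 ≤ n) {X : Type} [TopologicalSpace X]
    (hX : ∀ x : X, Subsingleton (HomotopyGroup (Fin n) X x)) {ι : Type} [Fintype ι]
    {s : Finset ι} (hs : s.card = n + 2) {φ : (ι → ℝ) → X}
    (hφ : ContinuousOn φ {x ∈ simplexFace s | vecSupport x ≠ s}) :
    ∃ Φ : (ι → ℝ) → X, ContinuousOn Φ (simplexFace s) ∧
      Set.EqOn Φ φ {x ∈ simplexFace s | vecSupport x ≠ s} := by
  classical
  let o : Fin (n + 2) ≃ s := (s.equivFinOfCardEq hs).symm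
  let a : (Fin (n + 1) → ℝ) → ι → ℝ := fun z j =>
    if h : j ∈ s then (Fin.cons (1 - ∑ i, z i) z : Fin (n + 2) → ℝ) (o.symm ⟨j, h⟩) else 0
  let b : (ι → ℝ) → Fin (n + 1) → ℝ := fun x i => x (o i.succ)
  have hac : Continuous a := by
    refine continuous_pi fun j => ?_
    simp only [a]
    split_ifs with h
    · refine Fin.cases ?_ (fun i => ?_) (o.symm ⟨j, h⟩)
      · simp only [Fin.cons_zero]; fun_prop
      · simp only [Fin.cons_succ]; fun_prop
    · exact continuous_const
  have hbc : Continuous b := by fun_prop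
  have hao (z i) : a z (o i) = (Fin.cons (1 - ∑ i, z i) z : Fin (n + 2) → ℝ) i := by simp [a]
  have hsum (x : ι → ℝ) (hx : vecSupport x ⊆ s) : ∑ j, x j = x (o 0) + ∑ i, b x i := by
    rw [← Finset.sum_subset (Finset.subset_univ s) fun j _ hj => by
        by_contra h
        exact hj (hx (mem_vecSupport.2 h)),
      ← Finset.sum_coe_sort, ← Equiv.sum_comp o, Fin.sum_univ_succ]
  have hasupp (z) : vecSupport (a z) ⊆ s := fun j hj => by
    by_contra h
    exact mem_vecSupport.1 hj (dif_neg h)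
  have hba (z) : b (a z) = z := by
    ext i
    simp only [b, hao, Fin.cons_succ]
  have hab {x} (hx : x ∈ simplexFace s) : a (b x) = x := by
    ext j
    by_cases hj : j ∈ s
    · obtain ⟨i, hi⟩ := o.surjective ⟨j, hj⟩
      have hi' : j = o i := by rw [hi]
      rw [hi', hao]
      refine Fin.cases ?_ (fun i => ?_) i
      · have := hsum x hx.2
        rw [hx.1.2] at this
        simp only [Fin.cons_zero]
        linarith
      · simp only [Fin.cons_succ, b]
    · have : x j = 0 := by
        by_contra h
        exact hj (hx.2 (mem_vecSupport.2 h))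
      rw [this]
      exact dif_neg hj
  have ha_mem {z} (hz : z ∈ cornerSimplex n) : a z ∈ simplexFace s := by
    refine ⟨⟨fun j => ?_, ?_⟩, hasupp z⟩
    · simp only [a]
      split_ifs with h
      · refine Fin.cases ?_ (fun i => ?_) (o.symm ⟨j, h⟩)
        · simpa using hz.2
        · simpa using hz.1 i
      · exact le_rfl
    · rw [hsum _ (hasupp z), hba, hao]
      simp
  have hb_mem {x} (hx : x ∈ simplexFace s) : b x ∈ cornerSimplex n := by
    refine ⟨fun i => hx.1.1 _, ?_⟩
    have := hsum x hx.2
    rw [hx.1.2] at this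
    linarith [hx.1.1 (o 0)]
  have hbd_a {z} (hz : z ∈ {z ∈ cornerSimplex n | (∃ i, z i = 0) ∨ ∑ i, z i = 1}) :
      a z ∈ {x ∈ simplexFace s | vecSupport x ≠ s} := by
    refine ⟨ha_mem hz.1, fun h => ?_⟩
    have hne (i) : a z (o i) ≠ 0 := by
      rw [← mem_vecSupport, h]
      exact (o i).2
    rcases hz.2 with ⟨i, hi⟩ | h1
    · exact hne i.succ (by rw [hao, Fin.cons_succ, hi])
    · exact hne 0 (by rw [hao, Fin.cons_zero, h1, sub_self])
  have hbd_b {x} (hx : x ∈ {x ∈ simplexFace s | vecSupport x ≠ s}) :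
      b x ∈ {z ∈ cornerSimplex n | (∃ i, z i = 0) ∨ ∑ i, z i = 1} := by
    refine ⟨hb_mem hx.1, ?_⟩
    obtain ⟨j, hj, hj'⟩ : ∃ j ∈ s, j ∉ vecSupport x :=
      Finset.not_subset.1 fun h => hx.2 (hx.1.2.antisymm h)
    rw [mem_vecSupport, not_not] at hj'
    obtain ⟨i, hi⟩ := o.surjective ⟨j, hj⟩
    replace hj' : x (o i) = 0 := by rw [hi, hj']
    rcases Fin.eq_zero_or_eq_succ i with rfl | ⟨i, rfl⟩
    · right
      have := hsum x hx.1.2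
      rw [hx.1.1.2, hj'] at this
      linarith
    · exact Or.inl ⟨i, hj'⟩
  obtain ⟨Φ, h1, h2⟩ := exists_extension_cornerSimplex hn hX (φ := φ ∘ a)
    (hφ.comp hac.continuousOn fun z hz => hbd_a hz)
  refine ⟨Φ ∘ b, h1.comp hbc.continuousOn fun x hx => hb_mem hx, fun x hx => ?_⟩
  rw [Function.comp_apply, h2 (hbd_b hx), Function.comp_apply, hab hx.1]

end

section

variable {ι : Type} [Fintype ι]

theorem vecSupport_nonempty {x : ι → ℝ} (hx : x ∈ stdSimplex ℝ ι) : (vecSupport x).Nonempty := by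
  by_contra h
  have h0 (i) : x i = 0 := by
    by_contra hi
    exact h ⟨i, mem_vecSupport.2 hi⟩
  have := hx.2
  simp [h0] at this

theorem convex_simplexFace (s : Finset ι) : Convex ℝ (simplexFace s) := by
  intro x hx y hy a b ha hb hab
  refine ⟨convex_stdSimplex ℝ ι hx.1 hy.1 ha hb hab, fun i hi => ?_⟩
  by_contra h
  have h1 : x i = 0 := by
    by_contra h'
    exact h (hx.2 (mem_vecSupport.2 h'))
  have h2 : y i = 0 := by
    by_contra h'
    exact h (hy.2 (mem_vecSupport.2 h'))
  simp [h1, h2] at hi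

theorem simplexFace_subset_simplexSkeleton {s : Finset ι} {j : ℕ} (hs : s.card ≤ j) :
    simplexFace s ⊆ simplexSkeleton ι j := fun _ hx =>
  ⟨hx.1, (Finset.card_le_card hx.2).trans hs⟩

variable [DecidableEq ι]

theorem vecSupport_single (i : ι) : vecSupport (Pi.single i (1 : ℝ)) = {i} := by
  ext a
  simp [Pi.single_apply]

theorem eq_single_of_vecSupport_subset {x : ι → ℝ} (hx : x ∈ stdSimplex ℝ ι) {i : ι}
    (h : vecSupport x ⊆ {i}) : x = Pi.single i 1 := by
  have h0 (j) (hj : j ≠ i) : x j = 0 := by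
    by_contra h'
    exact hj (Finset.mem_singleton.1 (h (mem_vecSupport.2 h')))
  have h1 : x i = 1 := by
    rw [← hx.2, Finset.sum_eq_single i (fun j _ hj => h0 j hj) (by simp)]
  ext j
  by_cases hj : j = i
  · rw [hj, h1, Pi.single_eq_same]
  · rw [h0 j hj, Pi.single_eq_of_ne hj]

theorem single_mem_simplexFace {s : Finset ι} {i : ι} (hi : i ∈ s) :
    Pi.single i 1 ∈ simplexFace s :=
  ⟨single_mem_stdSimplex ℝ i, by rwa [vecSupport_single, Finset.singleton_subset_iff]⟩

variable {Y : Type} [TopologicalSpace Y]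

/-- Extension over a single edge of the simplex. -/
theorem exists_extension_edge {f : (ι → ℝ) → Y} {s : Finset ι} (hs : s.card = 2) {A : Set Y}
    (hA : ∀ u ∈ s, ∀ v ∈ s, JoinedIn A (f (Pi.single u 1)) (f (Pi.single v 1))) :
    ∃ F : (ι → ℝ) → Y, ContinuousOn F (simplexFace s) ∧
      Set.EqOn F f {x ∈ simplexFace s | vecSupport x ≠ s} ∧ ∀ x ∈ simplexFace s, F x ∈ A := by
  obtain ⟨u, v, huv, rfl⟩ := Finset.card_eq_two.1 hs
  obtain ⟨γ, hγ⟩ := hA u (by simp) v (by simp)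
  refine ⟨fun x => γ.extend (x v),
    (γ.continuous_extend.comp (continuous_apply v)).continuousOn, fun x hx => ?_, fun x hx => ?_⟩
  · have hcases : vecSupport x ⊆ {u} ∨ vecSupport x ⊆ {v} := by
      by_contra! h
      refine hx.2 (hx.1.2.antisymm ?_)
      obtain ⟨h1, h2⟩ := h
      rw [Finset.not_subset] at h1 h2
      obtain ⟨a, ha, ha'⟩ := h1
      obtain ⟨c, hc, hc'⟩ := h2
      have h3 := hx.1.2 ha
      have h4 := hx.1.2 hc
      simp only [Finset.mem_insert, Finset.mem_singleton] at h3 h4 ha' hc'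
      have h5 : a = v := h3.resolve_left ha'
      have h6 : c = u := h4.resolve_right hc'
      subst h5 h6
      intro i hi
      rcases Finset.mem_insert.1 hi with rfl | hi
      · exact hc
      · rwa [Finset.mem_singleton.1 hi]
    rcases hcases with h | h
    · obtain rfl := eq_single_of_vecSupport_subset hx.1.1 h
      simp [Pi.single_eq_of_ne huv.symm]
    · obtain rfl := eq_single_of_vecSupport_subset hx.1.1 h
      simp
  · have hI : x v ∈ I := ⟨hx.1.1 v, by
      rw [← hx.1.2]
      exact Finset.single_le_sum (fun i _ => hx.1.1 i) (Finset.mem_univ v)⟩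
    simp only [γ.extend_apply hI]
    exact hγ _

/-- Extension over a single simplex of dimension at least two. -/
theorem exists_extension_face {n : ℕ} (hn : 1 ≤ n) {f : (ι → ℝ) → Y} {s : Finset ι}
    (hs : s.card = n + 2) {A : Set Y} (hf : ContinuousOn f (simplexSkeleton ι (n + 1)))
    (hfA : ∀ x ∈ simplexFace s, vecSupport x ≠ s → f x ∈ A)
    (hA : ∀ u ∈ s, ∀ v ∈ s, JoinedIn A (f (Pi.single u 1)) (f (Pi.single v 1)))
    (hconn : ∀ (x : A) (y : pathComponent x),
      Subsingleton (HomotopyGroup (Fin n) (pathComponent x) y)) :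
    ∃ F : (ι → ℝ) → Y, ContinuousOn F (simplexFace s) ∧
      Set.EqOn F f {x ∈ simplexFace s | vecSupport x ≠ s} ∧ ∀ x ∈ simplexFace s, F x ∈ A := by
  classical
  obtain ⟨u, hu⟩ : s.Nonempty := Finset.card_pos.1 (by omega)
  let x₀ : A := ⟨f (Pi.single u 1), (hA u hu u hu).source_mem⟩
  have hsub : {x ∈ simplexFace s | vecSupport x ≠ s} ⊆ simplexSkeleton ι (n + 1) := fun x hx => by
    refine ⟨hx.1.1, ?_⟩
    have := Finset.card_lt_card (hx.1.2.ssubset_of_ne hx.2)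
    omega
  have hjoin {x} (hx : x ∈ {x ∈ simplexFace s | vecSupport x ≠ s}) :
      JoinedIn A (f (Pi.single u 1)) (f x) := by
    obtain ⟨w, hw⟩ := vecSupport_nonempty hx.1.1
    refine (hA u hu w (hx.1.2 hw)).trans ?_
    have hx' : x ∈ simplexFace (vecSupport x) := ⟨hx.1.1, subset_rfl⟩
    have hseg : JoinedIn (simplexFace (vecSupport x)) (Pi.single w 1) x :=
      JoinedIn.of_segment_subset
        ((convex_simplexFace _).segment_subset (single_mem_simplexFace hw) hx')
    refine (hseg.map_continuousOn
      (hf.mono (simplexFace_subset_simplexSkeleton (hsub hx).2))).mono ?_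
    rintro _ ⟨y, hy, rfl⟩
    exact hfA y ⟨hy.1, hy.2.trans hx.1.2⟩ fun h =>
      hx.2 (hx.1.2.antisymm (h ▸ hy.2))
  let φ : (ι → ℝ) → pathComponent x₀ := fun x =>
    if hx : x ∈ {x ∈ simplexFace s | vecSupport x ≠ s} then
      ⟨⟨f x, (hjoin hx).target_mem⟩, (hjoin hx).joined_subtype⟩
    else ⟨x₀, mem_pathComponent_self _⟩
  have hφval {x} (hx : x ∈ {x ∈ simplexFace s | vecSupport x ≠ s}) : ((φ x : A) : Y) = f x := by
    simp only [φ, dif_pos hx]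
  have hφ : ContinuousOn φ {x ∈ simplexFace s | vecSupport x ≠ s} := by
    rw [Topology.IsInducing.subtypeVal.continuousOn_iff,
      Topology.IsInducing.subtypeVal.continuousOn_iff]
    exact (hf.mono hsub).congr fun x hx => hφval hx
  obtain ⟨Φ, h1, h2⟩ := exists_extension_simplexFace hn (hconn x₀) hs hφ
  refine ⟨fun x => ((Φ x : A) : Y),
    (continuous_subtype_val.comp continuous_subtype_val).comp_continuousOn h1, fun x hx => ?_,
    fun x _ => (Φ x : A).2⟩
  simp only [h2 hx, hφval hx]

/-- Extension of a map from a skeleton of the simplex to the next skeleton, given an extension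
over each face. -/
theorem exists_extension_skeleton {j : ℕ} {f : (ι → ℝ) → Y}
    (hf : ContinuousOn f (simplexSkeleton ι j)) {F : Finset ι → (ι → ℝ) → Y}
    (hF : ∀ s : Finset ι, s.card = j + 1 → ContinuousOn (F s) (simplexFace s) ∧
      Set.EqOn (F s) f {x ∈ simplexFace s | vecSupport x ≠ s}) :
    ContinuousOn (fun x => if (vecSupport x).card ≤ j then f x else F (vecSupport x) x)
      (simplexSkeleton ι (j + 1)) := by
  have hU : simplexSkeleton ι (j + 1) = ⋃ s : {s : Finset ι // s.card ≤ j + 1},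
      simplexFace s.1 := by
    rw [simplexSkeleton_eq_biUnion]
    ext
    simp
  rw [hU]
  refine (locallyFinite_of_finite _).continuousOn_iUnion (fun s => isClosed_simplexFace _) ?_
  rintro ⟨s, hs⟩
  rcases hs.lt_or_eq with h | h
  · refine (hf.mono (simplexFace_subset_simplexSkeleton (Nat.lt_succ_iff.1 h))).congr
      fun x hx => if_pos ((Finset.card_le_card hx.2).trans (Nat.lt_succ_iff.1 h))
  · refine (hF s h).1.congr fun x hx => ?_
    by_cases hsx : vecSupport x = s
    · simp only [hsx, h]
      simp
    · have := Finset.card_lt_card (hx.2.ssubset_of_ne hsx)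
      rw [(hF s h).2 ⟨hx, hsx⟩]
      exact if_pos (by omega)

/-- A monotone family of sets indexed by the faces of a simplex, with well-connected path
components and with compatible vertices and edges, contains a map of the skeleton. -/
theorem exists_map_simplexSkeleton [Nonempty ι] {k : ℕ} {B : Finset ι → Set Y}
    (hmono : Monotone B) {p : ι → Y} (hp : ∀ v, p v ∈ B {v})
    (hedge : ∀ u v, JoinedIn (B {u, v}) (p u) (p v))
    (hconn : ∀ s : Finset ι, ∀ n, 1 ≤ n → n ≤ k - 1 → ∀ (x : B s) (y : pathComponent x),
      Subsingleton (HomotopyGroup (Fin n) (pathComponent x) y))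
    {j : ℕ} (hj : j ≤ k) :
    ∃ f : (ι → ℝ) → Y, ContinuousOn f (simplexSkeleton ι (j + 1)) ∧
      (∀ x ∈ simplexSkeleton ι (j + 1), f x ∈ B (vecSupport x)) ∧
      ∀ v, f (Pi.single v 1) = p v := by
  induction j with
  | zero =>
    have hsk {x} (hx : x ∈ simplexSkeleton ι (0 + 1)) : ∃ v, x = Pi.single v 1 := by
      obtain ⟨v, hv⟩ := Finset.card_eq_one.1
        (le_antisymm hx.2 (Finset.card_pos.2 (vecSupport_nonempty hx.1)))
      exact ⟨v, eq_single_of_vecSupport_subset hx.1 hv.subset⟩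
    have hfin : (simplexSkeleton ι (0 + 1)).Finite :=
      (Set.finite_range fun v : ι => (Pi.single v 1 : ι → ℝ)).subset fun x hx => by
        obtain ⟨v, rfl⟩ := hsk hx
        exact ⟨v, rfl⟩
    have hval (v) : p (Classical.epsilon fun w => (Pi.single v 1 : ι → ℝ) w ≠ 0) = p v := by
      have := Classical.epsilon_spec (p := fun w => (Pi.single v 1 : ι → ℝ) w ≠ 0) ⟨v, by simp⟩
      congr 1
      by_contra h
      exact this (Pi.single_eq_of_ne h _)
    refine ⟨fun x => p (Classical.epsilon fun w => x w ≠ 0), hfin.continuousOn _, fun x hx => ?_,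
      hval⟩
    obtain ⟨v, rfl⟩ := hsk hx
    simp only [hval, vecSupport_single]
    exact hp v
  | succ j ih =>
    obtain ⟨f, hf, hfB, hfp⟩ := ih (by omega)
    have hext (s : Finset ι) : ∃ F : (ι → ℝ) → Y, s.card = j + 1 + 1 →
        ContinuousOn F (simplexFace s) ∧
        Set.EqOn F f {x ∈ simplexFace s | vecSupport x ≠ s} ∧ ∀ x ∈ simplexFace s, F x ∈ B s := by
      by_cases hs : s.card = j + 1 + 1
      · have hA (u) (hu : u ∈ s) (v) (hv : v ∈ s) :
            JoinedIn (B s) (f (Pi.single u 1)) (f (Pi.single v 1)) := by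
          rw [hfp, hfp]
          exact (hedge u v).mono (hmono (by
            intro w hw
            rcases Finset.mem_insert.1 hw with rfl | hw
            · exact hu
            · rwa [Finset.mem_singleton.1 hw]))
        rcases j.eq_zero_or_pos with rfl | hj0
        · obtain ⟨F, hF⟩ := exists_extension_edge hs hA
          exact ⟨F, fun _ => hF⟩
        · obtain ⟨F, hF⟩ := exists_extension_face hj0 hs hf (fun x hx hxs => by
            have := Finset.card_lt_card (hx.2.ssubset_of_ne hxs)
            exact hmono hx.2 (hfB x ⟨hx.1, by omega⟩)) hA (hconn s j hj0 (by omega))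
          exact ⟨F, fun _ => hF⟩
      · exact ⟨f, fun h => absurd h hs⟩
    choose F hF using hext
    refine ⟨_, exists_extension_skeleton hf (F := F) fun s hs => ⟨(hF s hs).1, (hF s hs).2.1⟩,
      fun x hx => ?_, fun v => ?_⟩
    · by_cases h : (vecSupport x).card ≤ j + 1
      · simp only [if_pos h]
        exact hfB x ⟨hx.1, h⟩
      · simp only [if_neg h]
        have := hx.2
        exact (hF _ (by omega)).2.2 x ⟨hx.1, subset_rfl⟩
    · simp [vecSupport_single, hfp]

end

/-- A monotone family of sets in `ℝ^d`, indexed by the faces of a simplex with sufficiently many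
vertices, with well-connected path components and with compatible vertices and edges, contains two
intersecting sets with disjoint indices. -/
theorem exists_not_disjoint_of_monotone {k d : ℕ} (hd : d ≤ 2 * k)
    {B : Finset (Fin (2 * k + 3)) → Set (Fin d → ℝ)} (hmono : Monotone B)
    {p : Fin (2 * k + 3) → Fin d → ℝ} (hp : ∀ v, p v ∈ B {v})
    (hedge : ∀ u v, JoinedIn (B {u, v}) (p u) (p v))
    (hconn : ∀ s, ∀ n, 1 ≤ n → n ≤ k - 1 → ∀ (x : B s) (y : pathComponent x),
      Subsingleton (HomotopyGroup (Fin n) (pathComponent x) y)) :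
    ∃ s t, Disjoint s t ∧ ¬ Disjoint (B s) (B t) := by
  obtain ⟨f, hf, hfB, -⟩ := exists_map_simplexSkeleton hmono hp hedge hconn le_rfl
  obtain ⟨x, hx, y, hy, hxy, h⟩ := van_kampen_flores hd hf
  exact ⟨_, _, hxy, Set.not_disjoint_iff.2 ⟨f x, hfB x hx, h ▸ hfB y hy⟩⟩

end Extension

/-- If every `r`-subset is coloured, large sets contain large subsets in which the colour of an
`(r + 1)`-subset only depends on its minimum. -/
theorem exists_endHomogeneous {κ : Type} [Nonempty κ] {r : ℕ}
    (hr : ∀ M : ℕ, ∃ N : ℕ, ∀ S : Finset ℕ, N ≤ S.card → ∀ c : Finset ℕ → κ,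
      ∃ T ⊆ S, T.card = M ∧ ∃ a : κ, ∀ Y ⊆ T, Y.card = r → c Y = a) (m : ℕ) :
    ∃ N : ℕ, ∀ S : Finset ℕ, N ≤ S.card → ∀ c : Finset ℕ → κ,
      ∃ T ⊆ S, T.card = m ∧ ∃ χ : ℕ → κ, ∀ x ∈ T, ∀ Z ⊆ T, (∀ z ∈ Z, x < z) → Z.card = r →
        c (insert x Z) = χ x := by
  induction m with
  | zero =>
    exact ⟨0, fun S _ c => ⟨∅, by simp, rfl, fun _ => Classical.arbitrary κ, by simp⟩⟩
  | succ m ih =>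
    obtain ⟨N₁, h₁⟩ := ih
    obtain ⟨N₂, h₂⟩ := hr N₁
    refine ⟨N₂ + 1, fun S hS c => ?_⟩
    have hne : S.Nonempty := Finset.card_pos.1 (by omega)
    set x := S.min' hne
    have hx : x ∈ S := S.min'_mem hne
    obtain ⟨T₂, hT₂, hc₂, a, ha⟩ := h₂ (S.erase x) (by rw [Finset.card_erase_of_mem hx]; omega)
      fun Z => c (insert x Z)
    obtain ⟨T₁, hT₁, hc₁, χ, hχ⟩ := h₁ T₂ hc₂.ge c
    have hlt (y) (hy : y ∈ T₁) : x < y := by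
      have h := hT₂ (hT₁ hy)
      exact lt_of_le_of_ne (S.min'_le y (Finset.mem_of_mem_erase h)) (Finset.ne_of_mem_erase h).symm
    have hxT : x ∉ T₁ := fun h => lt_irrefl _ (hlt x h)
    refine ⟨insert x T₁, Finset.insert_subset hx ((hT₁.trans hT₂).trans (Finset.erase_subset _ _)),
      by rw [Finset.card_insert_of_notMem hxT, hc₁], Function.update χ x a, ?_⟩
    intro y hy Z hZ hyZ hZc
    have hZ' : Z ⊆ T₁ := fun z hz => by
      refine (Finset.mem_insert.1 (hZ hz)).resolve_left fun h => ?_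
      subst h
      rcases Finset.mem_insert.1 hy with rfl | hy
      · exact lt_irrefl _ (hyZ _ hz)
      · exact lt_asymm (hyZ _ hz) (hlt _ hy)
    rcases Finset.mem_insert.1 hy with rfl | hy
    · rw [Function.update_self]
      exact ha Z (hZ'.trans hT₁) hZc
    · rw [Function.update_of_ne (hlt y hy).ne']
      exact hχ y hy Z hZ' hyZ hZc

/-- The finite **Ramsey theorem** for hypergraphs. -/
theorem exists_homogeneous (κ : Type) [Fintype κ] [Nonempty κ] (r M : ℕ) :
    ∃ N : ℕ, ∀ S : Finset ℕ, N ≤ S.card → ∀ c : Finset ℕ → κ,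
      ∃ T ⊆ S, T.card = M ∧ ∃ a : κ, ∀ Y ⊆ T, Y.card = r → c Y = a := by
  classical
  induction r generalizing M with
  | zero =>
    refine ⟨M, fun S hS c => ?_⟩
    obtain ⟨T, hT, hc⟩ := Finset.exists_subset_card_eq hS
    exact ⟨T, hT, hc, c ∅, fun Y _ hY => by rw [Finset.card_eq_zero.1 hY]⟩
  | succ r ih =>
    obtain ⟨N, hN⟩ := exists_endHomogeneous ih (Fintype.card κ * M + 1)
    refine ⟨N, fun S hS c => ?_⟩
    obtain ⟨T, hT, hc, χ, hχ⟩ := hN S hS c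
    obtain ⟨a, -, ha⟩ := Finset.exists_lt_card_fiber_of_mul_lt_card_of_maps_to
      (s := T) (t := Finset.univ) (f := χ) (n := M) (fun _ _ => Finset.mem_univ _)
      (by rw [Finset.card_univ, hc]; omega)
    obtain ⟨T', hT', hc'⟩ := Finset.exists_subset_card_eq ha.le
    have hsub : T' ⊆ T := hT'.trans (Finset.filter_subset _ _)
    refine ⟨T', hsub.trans hT, hc', a, fun Y hY hYc => ?_⟩
    have hne : Y.Nonempty := Finset.card_pos.1 (by omega)
    have hmem := Y.min'_mem hne
    have := hχ (Y.min' hne) (hsub (hY hmem)) (Y.erase (Y.min' hne))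
      (((Finset.erase_subset _ _).trans hY).trans hsub)
      (fun z hz => Y.min'_lt_of_mem_erase_min' hne hz)
      (by rw [Finset.card_erase_of_mem hmem, hYc]; omega)
    rw [Finset.insert_erase hmem] at this
    rw [this]
    exact (Finset.mem_filter.1 (hT' (hY hmem))).2

section Placement

variable (b m : ℕ)

/-- The number of positions reserved for one vertex and the fillers preceding it. -/
def zoneWidth : ℕ := m * m * (b + 1) + 1

/-- The position of the `l`-th filler of the edge `e` in the zone `z`. -/
def fillerCode (z e l : ℕ) : ℕ := z * zoneWidth b m + (e * (b + 1) + l)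

/-- The position of the vertex `v`. -/
def vertexCode (v : ℕ) : ℕ := v * zoneWidth b m + (zoneWidth b m - 1)

/-- The vertices of the simplex to which a position belongs. -/
def codeLabel [NeZero m] (x : ℕ) : Finset (Fin m) :=
  if x % zoneWidth b m = zoneWidth b m - 1 then {Fin.ofNat m (x / zoneWidth b m)}
  else {Fin.ofNat m (x % zoneWidth b m / (b + 1) / m),
    Fin.ofNat m (x % zoneWidth b m / (b + 1) % m)}

/-- The positions of the `b + 1` elements assigned to the edge from `u` to `v`, among which the
`i`-th one is the vertex `u` and the `j`-th one is the vertex `v`. -/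
def edgeCode (u v i j l : ℕ) : ℕ :=
  if l < i then fillerCode b m u (u * m + v) l
  else if l = i then vertexCode b m u
  else if l < j then fillerCode b m v (u * m + v) l
  else if l = j then vertexCode b m v
  else fillerCode b m (v + 1) (u * m + v) l

variable {b m}

theorem codeLabel_nonempty [NeZero m] (x : ℕ) : (codeLabel b m x).Nonempty := by
  unfold codeLabel
  split_ifs <;> simp

theorem codeLabel_vertexCode [NeZero m] (v : Fin m) :
    codeLabel b m (vertexCode b m v) = {v} := by
  have hW : 0 < zoneWidth b m := Nat.succ_pos _
  have h1 : vertexCode b m v % zoneWidth b m = zoneWidth b m - 1 := by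
    rw [vertexCode, Nat.mul_add_mod_self_right, Nat.mod_eq_of_lt (by omega)]
  have h2 : vertexCode b m v / zoneWidth b m = v := by
    rw [vertexCode, mul_comm, Nat.mul_add_div hW, Nat.div_eq_of_lt (by omega), add_zero]
  rw [codeLabel, if_pos h1, h2, Fin.ofNat_val_eq_self]

theorem filler_lt {u v l : ℕ} (hu : u < m) (hv : v < m) (hl : l < b + 1) :
    (u * m + v) * (b + 1) + l < zoneWidth b m - 1 := by
  have h1 : u * m + v + 1 ≤ m * m := by nlinarith
  have h2 : (u * m + v + 1) * (b + 1) ≤ m * m * (b + 1) := Nat.mul_le_mul_right _ h1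
  simp only [zoneWidth, Nat.add_sub_cancel]
  linarith

theorem codeLabel_fillerCode [NeZero m] (u v : Fin m) {l : ℕ} (hl : l < b + 1) (z : ℕ) :
    codeLabel b m (fillerCode b m z (u * m + v) l) = {u, v} := by
  have hlt := filler_lt u.2 v.2 hl
  have h1 : fillerCode b m z (u * m + v) l % zoneWidth b m = (u * m + v) * (b + 1) + l := by
    rw [fillerCode, Nat.mul_add_mod_self_right, Nat.mod_eq_of_lt (by omega)]
  have h2 : ((u * m + v : ℕ) * (b + 1) + l) / (b + 1) = u * m + v := by
    rw [mul_comm, Nat.mul_add_div (Nat.succ_pos b), Nat.div_eq_of_lt hl, add_zero]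
  have h3 : (u * m + v : ℕ) / m = u := by
    rw [mul_comm, Nat.mul_add_div (NeZero.pos m), Nat.div_eq_of_lt v.2, add_zero]
  have h4 : (u * m + v : ℕ) % m = v := by
    rw [Nat.mul_add_mod_self_right, Nat.mod_eq_of_lt v.2]
  rw [codeLabel, h1, if_neg hlt.ne, h2, h3, h4, Fin.ofNat_val_eq_self, Fin.ofNat_val_eq_self]

theorem codeLabel_edgeCode_subset [NeZero m] (u v : Fin m) {l : ℕ} (hl : l < b + 1) (i j : ℕ) :
    codeLabel b m (edgeCode b m u v i j l) ⊆ {u, v} := by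
  unfold edgeCode
  split_ifs
  all_goals simp [codeLabel_fillerCode, codeLabel_vertexCode, hl]

theorem edgeCode_lt {u v l : ℕ} (huv : u < v) (hv : v < m) (hl : l < b + 1) (i j : ℕ) :
    edgeCode b m u v i j l < (m + 1) * zoneWidth b m := by
  have hlt := filler_lt (huv.trans hv) hv hl
  have key (z x : ℕ) (hz : z ≤ m) (hx : x < zoneWidth b m) :
      z * zoneWidth b m + x < (m + 1) * zoneWidth b m := by nlinarith
  unfold edgeCode fillerCode vertexCode
  split_ifs <;> apply key <;> omega

theorem edgeCode_lt_edgeCode {u v i j l l' : ℕ} (huv : u < v) (hv : v < m) (hij : i < j)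
    (hl : l' < b + 1) (hll : l < l') : edgeCode b m u v i j l < edgeCode b m u v i j l' := by
  have hlt := filler_lt (huv.trans hv) hv hl
  have hlt' := filler_lt (huv.trans hv) hv (hll.trans hl)
  have key (z z' x x' : ℕ) (hx : x < zoneWidth b m) (h : z < z' ∨ z = z' ∧ x < x') :
      z * zoneWidth b m + x < z' * zoneWidth b m + x' := by
    rcases h with h | ⟨rfl, h⟩
    · nlinarith
    · omega
  unfold edgeCode fillerCode vertexCode
  split_ifs <;> first | omega | (apply key <;> omega)

theorem edgeCode_left {u v i j : ℕ} : edgeCode b m u v i j i = vertexCode b m u := by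
  simp [edgeCode]

theorem edgeCode_right {u v i j : ℕ} (hij : i < j) :
    edgeCode b m u v i j j = vertexCode b m v := by
  simp [edgeCode, hij.not_gt, hij.ne']

theorem vertexCode_lt {v : ℕ} (hv : v < m) : vertexCode b m v < (m + 1) * zoneWidth b m := by
  have : 0 < zoneWidth b m := Nat.succ_pos _
  unfold vertexCode
  have h : v * zoneWidth b m ≤ m * zoneWidth b m := Nat.mul_le_mul_right _ hv.le
  have h2 : (m + 1) * zoneWidth b m = m * zoneWidth b m + zoneWidth b m := by ring
  omega

end Placement

/-- If every `(b + 1)`-subset of a large set `S` contains a related pair, then the complete graph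
on `m` vertices can be placed in `S` with related edges, each edge having its own fillers. -/
theorem exists_placement (b m : ℕ) (hm : 2 ≤ m) :
    ∃ N : ℕ, ∀ S : Finset ℕ, N < S.card → ∀ J : Finset ℕ → ℕ → ℕ → Prop,
      (∀ Y ⊆ S, Y.card = b + 1 → ∃ x ∈ Y, ∃ y ∈ Y, x < y ∧ J Y x y) →
      ∃ T ⊂ S, ∃ (w : Fin m → ℕ) (δ : ℕ → Finset (Fin m)),
        (∀ x, (δ x).Nonempty) ∧ (∀ v, w v ∈ T ∧ δ (w v) = {v}) ∧
        ∀ u v, u < v → ∃ E ⊆ T, (∀ x ∈ E, δ x ⊆ {u, v}) ∧ J E (w u) (w v) := by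
  classical
  have : NeZero m := ⟨by omega⟩
  set M := (m + 1) * zoneWidth b m with hM
  obtain ⟨N, hN⟩ := exists_homogeneous (Fin (b + 1) × Fin (b + 1)) (b + 1) M
  refine ⟨max N M, fun S hS J hJ => ?_⟩
  let P : Finset ℕ → Fin (b + 1) × Fin (b + 1) → Prop := fun Y a =>
    a.1 < a.2 ∧ ∃ y : Fin (b + 1) → ℕ, StrictMono y ∧ Set.range y = Y ∧ J Y (y a.1) (y a.2)
  have hP (Y) (hY : Y ⊆ S) (hYc : Y.card = b + 1) : ∃ a, P Y a := by
    obtain ⟨x, hx, y, hy, hxy, hJY⟩ := hJ Y hY hYc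
    have hr := Finset.range_orderEmbOfFin Y hYc
    obtain ⟨i, rfl⟩ : x ∈ Set.range (Y.orderEmbOfFin hYc) := by rw [hr]; exact hx
    obtain ⟨j, rfl⟩ : y ∈ Set.range (Y.orderEmbOfFin hYc) := by rw [hr]; exact hy
    exact ⟨(i, j), (Y.orderEmbOfFin hYc).lt_iff_lt.1 hxy, _, (Y.orderEmbOfFin hYc).strictMono,
      hr, hJY⟩
  obtain ⟨T, hTS, hTc, a, ha⟩ := hN S (by omega) fun Y => Classical.epsilon (P Y)
  obtain ⟨i, j⟩ := a
  have hPT (Y) (hY : Y ⊆ T) (hYc : Y.card = b + 1) : P Y (i, j) := by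
    rw [← ha Y hY hYc]
    exact Classical.epsilon_spec (hP Y (hY.trans hTS) hYc)
  have hMpos : b + 1 ≤ M := by
    have h1 : (b + 1) ≤ zoneWidth b m := by
      unfold zoneWidth
      nlinarith [Nat.mul_le_mul hm hm]
    nlinarith
  have hij : i < j := by
    obtain ⟨Y, hY, hYc⟩ := Finset.exists_subset_card_eq (hTc ▸ hMpos)
    exact (hPT Y hY hYc).1
  let t := T.orderEmbOfFin hTc
  have htT (x) : t x ∈ T := T.orderEmbOfFin_mem hTc x
  refine ⟨T, hTS.ssubset_of_ne fun h => ?_, fun v => t ⟨_, vertexCode_lt v.2⟩,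
    Function.extend t (fun x => codeLabel b m x) fun _ => {0}, fun x => ?_, fun v => ⟨htT _, ?_⟩,
    fun u v huv => ?_⟩
  · have := congr_arg Finset.card h
    omega
  · by_cases h : ∃ y, t y = x
    · obtain ⟨y, rfl⟩ := h
      rw [t.injective.extend_apply]
      exact codeLabel_nonempty _
    · rw [Function.extend_apply' _ _ _ h]
      exact Finset.singleton_nonempty _
  · rw [t.injective.extend_apply]
    exact codeLabel_vertexCode v
  · let y : Fin (b + 1) → ℕ := fun l =>
      t ⟨edgeCode b m u v i j l, edgeCode_lt huv v.2 l.2 i j⟩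
    have hy : StrictMono y := fun l l' h =>
      t.strictMono (edgeCode_lt_edgeCode huv v.2 hij l'.2 h)
    have hET : Finset.univ.image y ⊆ T := by
      intro x hx
      obtain ⟨l, -, rfl⟩ := Finset.mem_image.1 hx
      exact htT _
    refine ⟨Finset.univ.image y, hET, fun x hx => ?_, ?_⟩
    · obtain ⟨l, -, rfl⟩ := Finset.mem_image.1 hx
      rw [t.injective.extend_apply]
      exact codeLabel_edgeCode_subset u v l.2 i j
    · obtain ⟨-, y', hy', hr, hJY⟩ := hPT _ hET
        (by rw [Finset.card_image_of_injective _ hy.injective, Finset.card_univ, Fintype.card_fin])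
      have hyy : y' = y := (hy'.range_inj hy).1 (by rw [hr]; simp)
      subst hyy
      convert hJY using 1
      · simp only [y, edgeCode_left]
      · simp only [y, edgeCode_right (Fin.lt_def.1 hij)]

/-- Among more points than path components, two can be joined by a path. -/
theorem exists_joinedIn_of_card_zerothHomotopy_lt {X : Type*} [TopologicalSpace X] {s : Set X}
    [Finite (ZerothHomotopy s)] {Y : Finset ℕ} (hY : Nat.card (ZerothHomotopy s) < Y.card)
    {p : ℕ → X} (hp : ∀ x ∈ Y, p x ∈ s) :
    ∃ x ∈ Y, ∃ y ∈ Y, x < y ∧ JoinedIn s (p x) (p y) := by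
  have := Fintype.ofFinite (ZerothHomotopy s)
  rw [Nat.card_eq_fintype_card, ← Fintype.card_coe] at hY
  obtain ⟨x, y, hxy, h⟩ := Fintype.exists_ne_map_eq_of_card_lt
    (β := ZerothHomotopy s) (fun x : Y => Quotient.mk _ ⟨p x, hp x x.2⟩) hY
  have hj : JoinedIn s (p x) (p y) :=
    joinedIn_iff_joined (hp x x.2) (hp y y.2) |>.2 (Quotient.exact h)
  rcases lt_or_gt_of_ne (Subtype.coe_ne_coe.2 hxy) with h | h
  · exact ⟨x, x.2, y, y.2, h, hj⟩
  · exact ⟨y, y.2, x, x.2, h, hj.symm⟩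

/-- **Matoušek's bounded Helly number theorem.**
For all `b, d ≥ 1` there is `N = f(b,d)` such that: if `ℱ` is a finite family of subsets
of `ℝ^d` such that the intersection of every nonempty subfamily has at most `b`
path-connected components, each of which (as a subspace) is `(⌈d/2⌉ − 1)`-connected, and
`⋂ℱ = ∅`, then some subfamily with at most `N` members has empty intersection. -/
theorem matousek_bounded_helly
    (b d : ℕ) (hb : 1 ≤ b) (hd : 1 ≤ d) :
    ∃ N : ℕ, ∀ ℱ : Finset (Set (Fin d → ℝ)),
      (∀ 𝒢 : Finset (Set (Fin d → ℝ)), 𝒢 ⊆ ℱ → 𝒢.Nonempty →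
        (Finite (ZerothHomotopy ↥(⋂₀ (𝒢 : Set (Set (Fin d → ℝ))))) ∧
          Nat.card (ZerothHomotopy ↥(⋂₀ (𝒢 : Set (Set (Fin d → ℝ))))) ≤ b) ∧
        (∀ x : ↥(⋂₀ (𝒢 : Set (Set (Fin d → ℝ)))),
          IsKConnectedSpace ((d + 1) / 2 - 1) ↥(pathComponent x))) →
      ⋂₀ (ℱ : Set (Set (Fin d → ℝ))) = ∅ →
      ∃ 𝒢 ⊆ ℱ, 𝒢.card ≤ N ∧ ⋂₀ (𝒢 : Set (Set (Fin d → ℝ))) = ∅ := by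
  classical
  obtain ⟨N, hN⟩ := exists_placement b (2 * ((d + 1) / 2) + 3) (by omega)
  refine ⟨max N (b + 1), fun ℱ hℱ hemp => ?_⟩
  obtain ⟨𝒢, -, ⟨h𝒢ℱ, h𝒢⟩, hmin⟩ := exists_minimal_le_of_wellFoundedLT
    (fun 𝒢 : Finset (Set (Fin d → ℝ)) => 𝒢 ⊆ ℱ ∧ ⋂₀ (𝒢 : Set (Set (Fin d → ℝ))) = ∅) ℱ
    ⟨subset_rfl, hemp⟩
  refine ⟨𝒢, h𝒢ℱ, ?_, h𝒢⟩
  by_contra! hcard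
  obtain ⟨hNcard, hbcard⟩ := max_lt_iff.1 hcard
  obtain ⟨ρ, hρ⟩ := Set.countable_iff_exists_injOn.1 𝒢.countable_toSet
  have hS : (𝒢.image ρ).card = 𝒢.card := Finset.card_image_of_injOn hρ
  let G (Y : Finset ℕ) : Finset (Set (Fin d → ℝ)) := {a ∈ 𝒢 | ρ a ∉ Y}
  let I (Y : Finset ℕ) : Set (Fin d → ℝ) := ⋂₀ (G Y : Set (Set (Fin d → ℝ)))
  have mem_I {Y x} : x ∈ I Y ↔ ∀ a ∈ 𝒢, ρ a ∉ Y → x ∈ a := by simp [I, G]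
  have hImono : Monotone I := fun Y Z hYZ x hx =>
    mem_I.2 fun a ha haZ => mem_I.1 hx a ha fun h => haZ (hYZ h)
  have hGℱ (Y) : G Y ⊆ ℱ := (Finset.filter_subset _ _).trans h𝒢ℱ
  have hGne {Y} (hY : ¬ 𝒢.image ρ ⊆ Y) : (G Y).Nonempty := by
    obtain ⟨x, hx, hxY⟩ := Finset.not_subset.1 hY
    obtain ⟨a, ha, rfl⟩ := Finset.mem_image.1 hx
    exact ⟨a, Finset.mem_filter.2 ⟨ha, hxY⟩⟩
  have hpt : ∀ x ∈ 𝒢.image ρ, ∃ p, p ∈ I {x} := by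
    intro x hx
    obtain ⟨a, ha, rfl⟩ := Finset.mem_image.1 hx
    by_contra! h
    have := hmin ⟨hGℱ {ρ a}, Set.eq_empty_of_forall_notMem h⟩ (Finset.filter_subset _ _) ha
    exact (Finset.mem_filter.1 this).2 (Finset.mem_singleton_self _)
  choose! p hp using hpt
  obtain ⟨T, hTS, w, δ, hδ, hw, hedge⟩ := hN (𝒢.image ρ) (by omega)
    (fun Y x y => JoinedIn (I Y) (p x) (p y)) fun Y hY hYc => by
      obtain ⟨⟨_, hle⟩, -⟩ := hℱ (G Y) (hGℱ Y) (hGne fun h => by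
        have := Finset.card_le_card h
        omega)
      exact exists_joinedIn_of_card_zerothHomotopy_lt (s := I Y) (hle.trans_lt (by omega))
        fun x hx => hImono (Finset.singleton_subset_iff.2 hx) (hp x (hY hx))
  let g (σ : Finset (Fin (2 * ((d + 1) / 2) + 3))) : Finset ℕ := {x ∈ T | δ x ⊆ σ}
  have hgmono : Monotone g := fun σ τ h =>
    Finset.monotone_filter_right _ fun x _ hx => hx.trans h
  have hlt {u v} (huv : u < v) : JoinedIn (I (g {u, v})) (p (w u)) (p (w v)) := by
    obtain ⟨E, hET, hE, hJ⟩ := hedge u v huv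
    exact hJ.mono (hImono fun x hx => Finset.mem_filter.2 ⟨hET hx, hE x hx⟩)
  have hwI (v) : p (w v) ∈ I (g {v}) := by
    refine hImono ?_ (hp (w v) (hTS.1 (hw v).1))
    simp [g, (hw v).1, (hw v).2]
  obtain ⟨σ, τ, hστ, hI⟩ := exists_not_disjoint_of_monotone (k := (d + 1) / 2) (d := d)
    (by omega) (B := fun σ => I (g σ)) (hImono.comp hgmono) (p := fun v => p (w v)) hwI
    (fun u v => by
      rcases lt_trichotomy u v with h | rfl | h
      · exact hlt h
      · exact JoinedIn.refl (hImono (hgmono (by simp)) (hwI u))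
      · rw [Finset.pair_comm]
        exact (hlt h).symm)
    (fun σ n hn hnk x y => ((hℱ (G (g σ)) (hGℱ _) (hGne fun h =>
      hTS.2 (h.trans (Finset.filter_subset _ _)))).2 x).2.2 n hn hnk y)
  refine hI (Set.disjoint_left.2 fun x hσ hτ => ?_)
  have : x ∈ ⋂₀ (𝒢 : Set (Set (Fin d → ℝ))) := fun a ha => by
    by_cases h : ρ a ∈ g σ
    · refine mem_I.1 hτ a ha fun h' => ?_
      obtain ⟨i, hi⟩ := hδ (ρ a)
      exact Finset.disjoint_left.1 hστ ((Finset.mem_filter.1 h).2 hi)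
        ((Finset.mem_filter.1 h').2 hi)
    · exact mem_I.1 hσ a ha h
  rw [h𝒢] at this
  exact this
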